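/- arXiv:math/0509516 — 5 statements merged into one kernel-verified Lean document; each statement's English description precedes it below -/
import Mathlib

section
/- If D is a pure injective R-module, then D is isomorphic to a direct summand of a direct product of a family of finitely embedded R-modules. -/
universe u

/-- A linear map is a pure monomorphism if it is injective and remains injective after
tensoring with every `R`-module. -/
def IsPureMono (R : Type u) [CommRing R] {M N : Type u} [AddCommGroup M] [Module R M]
    [AddCommGroup N] [Module R N] (f : M →ₗ[R] N) : Prop :=
  Function.Injective f ∧
    ∀ (L : Type u) [AddCommGroup L] [Module R L], Function.Injective (LinearMap.rTensor L f)

/-- A module `D` is pure injective if every homomorphism into `D` extends along every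
pure monomorphism. -/
def IsPureInjective (R : Type u) [CommRing R] (D : Type u) [AddCommGroup D] [Module R D] :
    Prop :=
  ∀ (M N : Type u) [AddCommGroup M] [Module R M] [AddCommGroup N] [Module R N]
    (f : M →ₗ[R] N), IsPureMono R f → ∀ g : M →ₗ[R] D, ∃ h : N →ₗ[R] D, h ∘ₗ f = g

/-- A module is finitely embedded if it embeds into the injective envelope of a direct sum
of finitely many simple modules, i.e. into an injective module which is an essential
extension of a finitely generated semisimple submodule. -/
def FinitelyEmbedded (R : Type u) [CommRing R] (M : Type u) [AddCommGroup M] [Module R M] :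
    Prop :=
  ∃ E : ModuleCat.{u} R, Module.Injective R E ∧
    ∃ S : Submodule R E, IsSemisimpleModule R S ∧ S.FG ∧
      (∀ P : Submodule R E, P ≠ ⊥ → S ⊓ P ≠ ⊥) ∧
      ∃ f : M →ₗ[R] E, Function.Injective f

universe v

open scoped TensorProduct

/-- `E` is an essential extension of `S` inside an ambient module. -/
def Submodule.IsEssentialExtension {R M : Type*} [Ring R] [AddCommGroup M] [Module R M]
    (S E : Submodule R M) : Prop :=
  S ≤ E ∧ ∀ x ∈ E, x ≠ 0 → ∃ r : R, r • x ∈ S ∧ r • x ≠ 0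

theorem Submodule.exists_maximal_isEssentialExtension {R M : Type*} [Ring R] [AddCommGroup M]
    [Module R M] (S : Submodule R M) :
    ∃ E : Submodule R M, Maximal (· ∈ {E | S.IsEssentialExtension E}) E := by
  obtain ⟨E, -, hE⟩ := zorn_le_nonempty₀ {E : Submodule R M | S.IsEssentialExtension E}
    (fun c hc hchain y hy => by
      refine ⟨sSup c, ⟨(hc hy).1.trans (le_sSup hy), fun x hx hx0 => ?_⟩, fun z hz => le_sSup hz⟩
      obtain ⟨E, hE, hxE⟩ := (Submodule.mem_sSup_of_directed ⟨y, hy⟩ hchain.directedOn).1 hx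
      exact (hc hE).2 x hxE hx0)
    S ⟨le_rfl, fun x hx hx0 => ⟨1, by simpa using hx, by simpa using hx0⟩⟩
  exact ⟨E, hE⟩

theorem Submodule.exists_maximal_disjoint {R M : Type*} [Ring R] [AddCommGroup M]
    [Module R M] (E : Submodule R M) :
    ∃ C : Submodule R M, Maximal (· ∈ {C | Disjoint E C}) C := by
  refine zorn_le₀ _ fun c hc hchain => ⟨sSup c, ?_, fun z hz => le_sSup hz⟩
  exact hchain.directedOn.disjoint_sSup_right.2 fun C hC => hc hC

theorem Module.Injective.of_retract {R : Type*} {I : Type v} {E : Type*} [Ring R]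
    [AddCommGroup I] [Module R I] [AddCommGroup E] [Module R E] [Small.{v} R]
    [Module.Injective R I]
    (s : E →ₗ[R] I) (p : I →ₗ[R] E) (hps : p ∘ₗ s = LinearMap.id) : Module.Injective R E where
  out X Y _ _ _ _ f hf g := by
    obtain ⟨h, hh⟩ := Module.Injective.extension_property R I X Y f hf (s ∘ₗ g)
    refine ⟨p ∘ₗ h, fun x => ?_⟩
    have h1 : h (f x) = s (g x) := LinearMap.congr_fun hh x
    have h2 : p (s (g x)) = g x := LinearMap.congr_fun hps (g x)
    simp [h1, h2]

/-- Every submodule of an injective module has an injective envelope inside that module. -/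
theorem Submodule.exists_injective_isEssentialExtension {R I : Type u} [Ring R]
    [AddCommGroup I] [Module R I] [Module.Injective R I] (S : Submodule R I) :
    ∃ E : Submodule R I, S.IsEssentialExtension E ∧ Module.Injective R E := by
  obtain ⟨E, hE, hEmax⟩ := S.exists_maximal_isEssentialExtension
  obtain ⟨C, hC, hCmax⟩ := E.exists_maximal_disjoint
  set i : E →ₗ[R] I ⧸ C := C.mkQ ∘ₗ E.subtype with hi
  have hinj : Function.Injective i := by
    rw [injective_iff_map_eq_zero]
    intro e he
    have heC : (e : I) ∈ C := by simpa [hi] using he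
    exact Subtype.ext (Submodule.disjoint_def.1 hC _ e.2 heC)
  obtain ⟨h, hh⟩ := Module.Injective.extension_property R I E (I ⧸ C) i hinj E.subtype
  have hhi : ∀ e : E, h (i e) = e := LinearMap.congr_fun hh
  have ess : ∀ y : I ⧸ C, y ≠ 0 → ∃ (r : R) (e : E), r • y = i e ∧ e ≠ 0 := by
    intro y hy
    obtain ⟨x, rfl⟩ := C.mkQ_surjective y
    have hx : x ∉ C := by simpa using hy
    have hnd : ¬ Disjoint E (C ⊔ Submodule.span R {x}) := fun hd =>
      hx (hCmax hd le_sup_left (Submodule.mem_sup_right (Submodule.mem_span_singleton_self x)))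
    rw [Submodule.disjoint_def] at hnd
    push Not at hnd
    obtain ⟨e, heE, heC, he0⟩ := hnd
    obtain ⟨c, hc, z, hz, rfl⟩ := Submodule.mem_sup.1 heC
    obtain ⟨r, rfl⟩ := Submodule.mem_span_singleton.1 hz
    refine ⟨r, ⟨_, heE⟩, ?_, fun h0 => he0 (congrArg Subtype.val h0)⟩
    have hc0 : C.mkQ c = 0 := by simpa using hc
    simp only [hi, LinearMap.comp_apply, Submodule.subtype_apply, map_add, hc0, zero_add, map_smul]
  have hrange : LinearMap.range h ≤ E := by
    refine hEmax ⟨fun s hs => ⟨i ⟨s, hE.1 hs⟩, hhi _⟩, ?_⟩ fun e he => ⟨i ⟨e, he⟩, hhi _⟩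
    rintro _ ⟨y, rfl⟩ hy
    obtain ⟨r, e, hre, he⟩ := ess y fun h0 => hy (by rw [h0, map_zero])
    obtain ⟨r', hr'S, hr'0⟩ := hE.2 e e.2 (by simpa using he)
    have key : (r' * r) • h y = r' • (e : I) := by rw [mul_smul, ← map_smul, hre, hhi]
    exact ⟨r' * r, key ▸ hr'S, key ▸ hr'0⟩
  refine ⟨E, hE, Module.Injective.of_retract E.subtype
    ((h ∘ₗ C.mkQ).codRestrict E fun x => hrange ⟨_, rfl⟩) ?_⟩
  ext e
  exact hhi e

theorem Module.exists_injective_embedding {R : Type u} [Ring R] (M : Type u)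
    [AddCommGroup M] [Module R M] :
    ∃ (I : ModuleCat.{u} R) (f : M →ₗ[R] I), Module.Injective R I ∧ Function.Injective f := by
  let J := CategoryTheory.Injective.under (ModuleCat.of R M)
  let f := CategoryTheory.Injective.ι (ModuleCat.of R M)
  have hJ : CategoryTheory.Injective (ModuleCat.of R J) :=
    inferInstanceAs (CategoryTheory.Injective J)
  exact ⟨J, f.hom, Module.injective_module_of_injective_object R J,
    (ModuleCat.mono_iff_injective f).1 inferInstance⟩

/-- Existence of injective envelopes. -/
theorem Module.exists_injective_envelope {R : Type u} [Ring R] (M : Type u)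
    [AddCommGroup M] [Module R M] :
    ∃ (E : ModuleCat.{u} R) (f : M →ₗ[R] E), Module.Injective R E ∧ Function.Injective f ∧
      ∀ x : E, x ≠ 0 → ∃ r : R, r • x ∈ LinearMap.range f ∧ r • x ≠ 0 := by
  obtain ⟨I, f, hI, hf⟩ := Module.exists_injective_embedding (R := R) M
  obtain ⟨E, hE, hEinj⟩ := (LinearMap.range f).exists_injective_isEssentialExtension
  refine ⟨ModuleCat.of R E, f.codRestrict E fun x => hE.1 ⟨x, rfl⟩, hEinj,
    fun x y hxy => hf (congrArg Subtype.val hxy), fun x hx => ?_⟩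
  obtain ⟨r, ⟨y, hy⟩, hr0⟩ := hE.2 x x.2 fun h0 => hx (Subtype.ext h0)
  exact ⟨r, ⟨y, Subtype.ext hy⟩, fun h0 => hr0 (congrArg Subtype.val h0)⟩

theorem exists_smul_mem_of_essential_pi {R M ι : Type*} [Ring R] [AddCommGroup M] [Module R M]
    (S : Submodule R M) (hS : ∀ x : M, x ≠ 0 → ∃ r : R, r • x ∈ S ∧ r • x ≠ 0)
    (s : Finset ι) (x : ι → M) (hx : x ≠ 0) :
    ∃ r : R, (∀ i ∈ s, r • x i ∈ S) ∧ r • x ≠ 0 := by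
  classical
  induction s using Finset.induction_on with
  | empty => exact ⟨1, by simp, by simpa using hx⟩
  | insert i s _ ih =>
    obtain ⟨r, hr, hr0⟩ := ih
    by_cases hi : r • x i = 0
    · exact ⟨r, Finset.forall_mem_insert _ _ _ |>.2 ⟨hi ▸ S.zero_mem, hr⟩, hr0⟩
    · obtain ⟨r', hr', hr'0⟩ := hS _ hi
      refine ⟨r' * r, Finset.forall_mem_insert _ _ _ |>.2 ⟨?_, fun j hj => ?_⟩, fun h0 => ?_⟩
      · rwa [mul_smul]
      · rw [mul_smul]
        exact S.smul_mem _ (hr j hj)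
      · exact hr'0 (by simpa [mul_smul] using congrFun h0 i)

theorem FinitelyEmbedded.of_injective {R : Type u} [CommRing R] {M N : Type u} [AddCommGroup M]
    [Module R M] [AddCommGroup N] [Module R N] (hN : FinitelyEmbedded R N) (f : M →ₗ[R] N)
    (hf : Function.Injective f) : FinitelyEmbedded R M := by
  obtain ⟨E, hE, S, hS, hfg, hess, g, hg⟩ := hN
  exact ⟨E, hE, S, hS, hfg, hess, g ∘ₗ f, hg.comp hf⟩

/-- A finite power of the injective envelope of a simple module is finitely embedded. -/
theorem finitelyEmbedded_pi {R : Type u} [CommRing R] {T E : Type u} [AddCommGroup T]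
    [Module R T] [IsSimpleModule R T] [AddCommGroup E] [Module R E] [Module.Injective R E]
    (f : T →ₗ[R] E) (hess : ∀ x : E, x ≠ 0 → ∃ r : R, r • x ∈ LinearMap.range f ∧ r • x ≠ 0)
    (n : ℕ) : FinitelyEmbedded R (Fin n → E) := by
  let F : (Fin n → T) →ₗ[R] (Fin n → E) := LinearMap.pi fun i => f ∘ₗ LinearMap.proj i
  refine ⟨ModuleCat.of R (Fin n → E), inferInstanceAs (Module.Injective R (Fin n → E)),
    LinearMap.range F, IsSemisimpleModule.range F, ?_, fun P hP h => ?_, LinearMap.id, Function.injective_id⟩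
  · exact Module.Finite.iff_fg.1 (Module.Finite.range F)
  · obtain ⟨x, hxP, hx0⟩ := P.ne_bot_iff.1 hP
    obtain ⟨r, hr, hr0⟩ :=
      exists_smul_mem_of_essential_pi (LinearMap.range f) hess Finset.univ x hx0
    choose y hy using fun i => hr i (Finset.mem_univ i)
    have hmem : r • x ∈ LinearMap.range F ⊓ P := ⟨⟨y, funext hy⟩, P.smul_mem r hxP⟩
    rw [h] at hmem
    exact hr0 hmem

theorem exists_linearMap_apply_ne_zero {R : Type u} [CommRing R] {M : Type u} [AddCommGroup M]
    [Module R M] {x : M} (hx : x ≠ 0) :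
    ∃ m : Ideal R, m.IsMaximal ∧ ∀ (E : Type u) [AddCommGroup E] [Module R E]
      [Module.Injective R E] (f : (R ⧸ m) →ₗ[R] E), Function.Injective f →
      ∃ φ : M →ₗ[R] E, φ x ≠ 0 := by
  set I : Ideal R := LinearMap.ker (LinearMap.toSpanSingleton R M x) with hI
  have hI1 : I ≠ ⊤ := by
    rw [Ideal.ne_top_iff_one]
    simpa [hI] using hx
  obtain ⟨m, hm, hIm⟩ := I.exists_le_maximal hI1
  refine ⟨m, hm, fun E _ _ _ f hf => ?_⟩
  let j : (R ⧸ I) →ₗ[R] M := Submodule.liftQ I (LinearMap.toSpanSingleton R M x) le_rfl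
  have hj : Function.Injective j :=
    LinearMap.ker_eq_bot.1 (Submodule.ker_liftQ_eq_bot _ _ _ le_rfl)
  obtain ⟨φ, hφ⟩ := Module.Injective.extension_property R E (R ⧸ I) M j hj
    (f ∘ₗ Submodule.factor hIm)
  have h1 : φ x = f (Submodule.Quotient.mk 1) := by
    have h2 : j (Submodule.Quotient.mk 1) = x := one_smul R x
    rw [← h2]
    exact LinearMap.congr_fun hφ (Submodule.Quotient.mk 1)
  refine ⟨φ, fun h0 => ?_⟩
  rw [h1, ← map_zero f] at h0
  exact (Ideal.ne_top_iff_one m).1 hm.ne_top ((Submodule.Quotient.mk_eq_zero m).1 (hf h0))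

/-- Nonzero tensors with a finitely generated module are detected by finitely embedded
quotients. -/
theorem exists_finitelyEmbedded_quotient_lTensor_ne_zero {R : Type u} [CommRing R]
    {L D : Type u} [AddCommGroup L] [Module R L] [Module.Finite R L] [AddCommGroup D]
    [Module R D] {t : L ⊗[R] D} (ht : t ≠ 0) :
    ∃ N : Submodule R D, FinitelyEmbedded R (D ⧸ N) ∧ LinearMap.lTensor L N.mkQ t ≠ 0 := by
  obtain ⟨m, hm, hφ⟩ := exists_linearMap_apply_ne_zero (R := R) ht
  have : IsSimpleModule R (R ⧸ m) := isSimpleModule_iff_isCoatom.2 hm.out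
  obtain ⟨E, f, hE, hf, hess⟩ := Module.exists_injective_envelope (R := R) (R ⧸ m)
  obtain ⟨φ, hφt⟩ := hφ E f hf
  obtain ⟨n, p, hp⟩ := Module.Finite.exists_fin' R L
  let ψ : D →ₗ[R] L →ₗ[R] E := (TensorProduct.curry φ).flip
  let ψ' : (D ⧸ LinearMap.ker ψ) →ₗ[R] L →ₗ[R] E := (LinearMap.ker ψ).liftQ ψ le_rfl
  have hψ' : Function.Injective ψ' :=
    LinearMap.ker_eq_bot.1 (Submodule.ker_liftQ_eq_bot _ _ _ le_rfl)
  let ev : (L →ₗ[R] E) →ₗ[R] (Fin n → E) :=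
    LinearMap.pi fun i => LinearMap.applyₗ (p (Pi.single i 1))
  have hev : Function.Injective ev := by
    intro a b hab
    refine LinearMap.cancel_right hp |>.1 (LinearMap.pi_ext' fun i => LinearMap.ext_ring ?_)
    exact congrFun hab i
  refine ⟨LinearMap.ker ψ,
    (finitelyEmbedded_pi f hess n).of_injective (ev ∘ₗ ψ') (hev.comp hψ'), fun h0 => hφt ?_⟩
  have hfac : φ = TensorProduct.lift ψ'.flip ∘ₗ LinearMap.lTensor L (LinearMap.ker ψ).mkQ :=
    TensorProduct.ext' fun l d => rfl
  rw [hfac, LinearMap.comp_apply, h0, map_zero]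

/-- Injectivity after tensoring can be tested on finitely generated modules. -/
theorem LinearMap.lTensor_injective_of_forall_fg {R : Type*} [CommRing R] {D P L : Type*}
    [AddCommGroup D] [Module R D] [AddCommGroup P] [Module R P] [AddCommGroup L] [Module R L]
    (f : D →ₗ[R] P)
    (h : ∀ Q : Submodule R L, Q.FG → Function.Injective (LinearMap.lTensor Q f)) :
    Function.Injective (LinearMap.lTensor L f) := by
  rw [injective_iff_map_eq_zero]
  intro t ht
  obtain ⟨Q₀, hQ₀, t, rfl⟩ := TensorProduct.exists_of_fg t
  have h1 : LinearMap.rTensor P Q₀.subtype (LinearMap.lTensor Q₀ f t) = 0 := by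
    rw [← ht, ← LinearMap.comp_apply, ← LinearMap.comp_apply, LinearMap.rTensor_comp_lTensor,
      LinearMap.lTensor_comp_rTensor]
  obtain ⟨Q, hQ₀Q, hQ, h2⟩ := TensorProduct.eq_zero_of_fg_of_subtype_eq_zero hQ₀ h1
  have h3 : LinearMap.rTensor D (Submodule.inclusion hQ₀Q) t = 0 := by
    refine h Q hQ ?_
    rw [map_zero, ← h2, ← LinearMap.comp_apply, ← LinearMap.comp_apply,
      LinearMap.rTensor_comp_lTensor, LinearMap.lTensor_comp_rTensor]
  rw [← Submodule.subtype_comp_inclusion _ _ hQ₀Q, LinearMap.rTensor_comp, LinearMap.comp_apply,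
    h3, map_zero]

/-- The canonical map from a module to the product of its finitely embedded quotients. -/
def toPiFinitelyEmbedded (R : Type u) [CommRing R] (D : Type u) [AddCommGroup D] [Module R D] :
    D →ₗ[R] ∀ N : {N : Submodule R D // FinitelyEmbedded R (D ⧸ N)}, D ⧸ N.1 :=
  LinearMap.pi fun N => N.1.mkQ

theorem isPureMono_toPiFinitelyEmbedded (R : Type u) [CommRing R] (D : Type u) [AddCommGroup D]
    [Module R D] : IsPureMono R (toPiFinitelyEmbedded R D) := by
  have key : ∀ (L : Type u) [AddCommGroup L] [Module R L],
      Function.Injective (LinearMap.lTensor L (toPiFinitelyEmbedded R D)) := by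
    intro L _ _
    refine LinearMap.lTensor_injective_of_forall_fg _ fun Q hQ => ?_
    have : Module.Finite R Q := Module.Finite.iff_fg.2 hQ
    rw [injective_iff_map_eq_zero]
    intro t ht
    by_contra ht0
    obtain ⟨N, hN, hNt⟩ := exists_finitelyEmbedded_quotient_lTensor_ne_zero ht0
    apply hNt
    have hfac : N.mkQ = LinearMap.proj (⟨N, hN⟩ : {N : Submodule R D //
        FinitelyEmbedded R (D ⧸ N)}) ∘ₗ toPiFinitelyEmbedded R D := rfl
    rw [hfac, LinearMap.lTensor_comp, LinearMap.comp_apply, ht, map_zero]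
  refine ⟨fun x y hxy => ?_, fun L _ _ => (LinearMap.lTensor_inj_iff_rTensor_inj ..).1 (key L)⟩
  apply (TensorProduct.lid R D).symm.injective
  apply key R
  simp [hxy]


theorem pureInjective_summand_of_prod_finitelyEmbedded (R : Type u) [CommRing R]
    (D : Type u) [AddCommGroup D] [Module R D] (hD : IsPureInjective R D) :
    ∃ (ι : Type u) (Q : ι → ModuleCat.{u} R), (∀ i, FinitelyEmbedded R (Q i)) ∧
      ∃ (f : D →ₗ[R] ∀ i, Q i) (g : (∀ i, Q i) →ₗ[R] D), g ∘ₗ f = LinearMap.id := by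
  obtain ⟨g, hg⟩ := hD _ _ (toPiFinitelyEmbedded R D) (isPureMono_toPiFinitelyEmbedded R D)
    LinearMap.id
  exact ⟨{N : Submodule R D // FinitelyEmbedded R (D ⧸ N)}, fun N => ModuleCat.of R (D ⧸ N.1),
    fun N => N.2, toPiFinitelyEmbedded R D, g, hg⟩
end

section
/- Over a Noetherian commutative ring R, an R-module D is pure injective if and only if D is isomorphic to a direct summand of a direct product of a family of Artinian R-modules. -/
universe u

open Polynomial TensorProduct

section Matlis
variable {R : Type*} [CommRing R] {X : Type*} [AddCommGroup X] [Module R X]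

/-- The ideal of the Rees algebra of `m` whose homogeneous elements of degree `n` are the elements
of `m ^ n` killing every element of `P` that is killed by `m ^ (n + 1)`. -/
def reesAnnihilator (m : Ideal R) (P : Submodule R X) : Ideal (reesAlgebra m) where
  carrier := {p | ∀ n, ∀ y ∈ P, (∀ a ∈ m ^ (n + 1), a • y = 0) → (p : R[X]).coeff n • y = 0}
  add_mem' {p q} hp hq n y hy h := by simp [add_smul, hp n y hy h, hq n y hy h]
  zero_mem' n y _ _ := by simp
  smul_mem' q p hp n y hy h := by
    simp only [smul_eq_mul, MulMemClass.coe_mul, coeff_mul, Finset.sum_smul]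
    refine Finset.sum_eq_zero fun ij hij ↦ ?_
    replace hij := Finset.HasAntidiagonal.mem_antidiagonal.1 hij
    rw [mul_comm, mul_smul]
    refine hp _ _ (P.smul_mem _ hy) fun a ha ↦ ?_
    rw [smul_smul]
    refine h _ ?_
    rw [show n + 1 = ij.2 + 1 + ij.1 by omega, pow_add]
    exact Ideal.mul_mem_mul ha (q.2 _)

lemma exists_sub_smul_vanish {F S : Type*} [AddCommGroup F] [Module R F] [AddCommGroup S]
    [Module R S] (hS : ∀ y z : S, y ≠ 0 → ∃ r : R, z = r • y) (K : Submodule R F)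
    (f g : F →ₗ[R] S) (h : K ⊓ LinearMap.ker f ≤ LinearMap.ker g) :
    ∃ r : R, K ≤ LinearMap.ker (g - r • f) := by
  by_cases hK : K ≤ LinearMap.ker f
  · exact ⟨0, by simpa [inf_eq_left.2 hK] using h⟩
  obtain ⟨v, hv, hfv⟩ := Set.not_subset.1 hK
  obtain ⟨r, hr⟩ := hS (f v) (g v) hfv
  refine ⟨r, fun w hw ↦ ?_⟩
  obtain ⟨s, hs⟩ := hS (f v) (f w) hfv
  have := @h (w - s • v) ⟨K.sub_mem hw (K.smul_mem s hv), by simp [hs]⟩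
  simp only [LinearMap.mem_ker, map_sub, map_smul, sub_eq_zero] at this
  simp [this, hs, hr, smul_comm r s]

lemma mem_of_iInf_ker_le {F S : Type*} [AddCommGroup F] [Module R F] [AddCommGroup S]
    [Module R S] [IsArtinian R F]
    (hS : ∀ y z : S, y ≠ 0 → ∃ r : R, z = r • y) (Q : Submodule R (F →ₗ[R] S))
    (g : F →ₗ[R] S) (h : ∀ v, (∀ q ∈ Q, q v = 0) → g v = 0) : g ∈ Q := by
  classical
  obtain ⟨_, ⟨t, ht, rfl⟩, hmin⟩ := IsArtinian.set_has_minimal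
    {K : Submodule R F | ∃ t : Finset (F →ₗ[R] S), (∀ q ∈ t, q ∈ Q) ∧
      K = t.inf LinearMap.ker} ⟨⊤, ∅, by simp⟩
  have key : t.inf LinearMap.ker ≤ LinearMap.ker g := by
    intro v hv
    refine h v fun q hq ↦ ?_
    by_contra hqv
    refine hmin _ ⟨insert q t, by simpa [hq] using ht, rfl⟩ ?_
    rw [Finset.inf_insert]
    refine lt_of_le_of_ne inf_le_right fun e ↦ hqv ?_
    rw [← e] at hv
    exact hv.1
  clear hmin h
  induction t using Finset.induction_on generalizing g with
  | empty =>
    have : g = 0 := LinearMap.ker_eq_top.1 (top_le_iff.1 (by simpa using key))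
    simp [this]
  | insert q t _ ih =>
    rw [Finset.inf_insert, inf_comm] at key
    obtain ⟨r, hr⟩ := exists_sub_smul_vanish hS _ _ _ key
    have := ih (g - r • q) (fun q hq ↦ ht q (by simp [hq])) hr
    simpa using Q.add_mem this (Q.smul_mem r (ht q (by simp)))

lemma mem_of_iInf_ker_le_of_smul {F S : Type*} [AddCommGroup F] [Module R F] [Module.Finite R F]
    [AddCommGroup S] [Module R S] (m : Ideal R) [hm : m.IsMaximal]
    (hS : ∀ y z : S, y ≠ 0 → ∃ r : R, z = r • y) (hmS : ∀ a ∈ m, ∀ y : S, a • y = 0)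
    (Q : Submodule R (F →ₗ[R] S))
    (g : F →ₗ[R] S) (h : ∀ v, (∀ q ∈ Q, q v = 0) → g v = 0) : g ∈ Q := by
  have hle (q : F →ₗ[R] S) : m • (⊤ : Submodule R F) ≤ LinearMap.ker q :=
    Submodule.smul_le.2 fun a ha v _ ↦ by simp [hmS a ha]
  let := Ideal.Quotient.field m
  have : Module.Finite (R ⧸ m) (F ⧸ m • (⊤ : Submodule R F)) :=
    Module.Finite.of_restrictScalars_finite R _ _
  have : IsArtinian R (F ⧸ m • (⊤ : Submodule R F)) :=
    isArtinian_of_surjective_algebraMap (R := R ⧸ m) Ideal.Quotient.mk_surjective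
  have := mem_of_iInf_ker_le hS (Q.comap (LinearMap.lcomp R S (m • (⊤ : Submodule R F)).mkQ))
    (Submodule.liftQ _ g (hle g)) ?_
  · simpa [Submodule.mem_comap, LinearMap.lcomp_apply', Submodule.liftQ_mkQ] using this
  · intro v
    obtain ⟨v, rfl⟩ := Submodule.mkQ_surjective _ v
    intro hv
    simp only [Submodule.mkQ_apply, Submodule.liftQ_apply]
    refine h v fun q hq ↦ ?_
    simpa using hv (Submodule.liftQ _ q (hle q))
      (by simpa [Submodule.mem_comap, LinearMap.lcomp_apply', Submodule.liftQ_mkQ] using hq)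

variable [IsNoetherianRing R]

/-- Over a Noetherian ring, a module with a nonzero element contained in every nonzero submodule
is Artinian. -/
theorem isArtinian_of_forall_mem {x : X} (hx : x ≠ 0)
    (h : ∀ P : Submodule R X, P ≠ ⊥ → x ∈ P) : IsArtinian R X := by
  have hspan (y : X) (hy : y ≠ 0) : ∃ r : R, r • y = x :=
    Submodule.mem_span_singleton.1 (h _ (by simpa using hy))
  let m : Ideal R := LinearMap.ker (LinearMap.toSpanSingleton R X x)
  have mem_m (a : R) : a ∈ m ↔ a • x = 0 := by simp [m]
  have hinv (a : R) (ha : a ∉ m) : ∃ b : R, 1 - b * a ∈ m := by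
    obtain ⟨r, hr⟩ := hspan (a • x) (by simpa [mem_m] using ha)
    exact ⟨r, by simp [mem_m, sub_smul, mul_smul, hr]⟩
  have hm : m.IsMaximal := by
    rw [Ideal.isMaximal_iff]
    refine ⟨by simpa [mem_m] using hx, fun J a hJ ha haJ ↦ ?_⟩
    obtain ⟨b, hb⟩ := hinv a ha
    simpa using J.add_mem (hJ hb) (J.mul_mem_left b haJ)
  -- the elements killed by `m` form a simple module
  have hsimple (y z : X) (hy : ∀ a ∈ m, a • y = 0) (hz : ∀ a ∈ m, a • z = 0) (hy0 : y ≠ 0) :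
      ∃ r : R, z = r • y := by
    have key (w : X) (hw : ∀ a ∈ m, a • w = 0) (hw0 : w ≠ 0) : ∃ s : R, s • x = w := by
      obtain ⟨r, hr⟩ := hspan w hw0
      obtain ⟨b, hb⟩ := hinv r fun hrm ↦ hx (by rw [← hr, hw r hrm])
      refine ⟨b, ?_⟩
      have := hw _ hb
      rw [sub_smul, one_smul, mul_smul, hr, sub_eq_zero] at this
      exact this.symm
    by_cases hz0 : z = 0
    · exact ⟨0, by simp [hz0]⟩
    obtain ⟨s, rfl⟩ := key z hz hz0
    obtain ⟨r, hr⟩ := hspan y hy0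
    exact ⟨s * r, by rw [mul_smul, hr]⟩
  -- every element is killed by a power of `m`
  have htors (y : X) : ∃ n, ∀ a ∈ m ^ n, a • y = 0 := by
    let I : Ideal R := LinearMap.ker (LinearMap.toSpanSingleton R X y)
    suffices hrad : m ≤ I.radical by
      obtain ⟨n, hn⟩ := Ideal.exists_pow_le_of_le_radical_of_fg hrad (IsNoetherian.noetherian m)
      exact ⟨n, fun a ha ↦ by simpa [I] using hn ha⟩
    intro a ha
    let K : ℕ →o Ideal R := ⟨fun n ↦ I.colon {a ^ n}, monotone_nat_of_le_succ fun n r hr ↦ by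
      simp only [Submodule.mem_colon_singleton, smul_eq_mul] at *
      rw [pow_succ, ← mul_assoc]
      exact I.mul_mem_right _ hr⟩
    obtain ⟨n, hn⟩ := monotone_stabilizes_iff_noetherian.2 (inferInstance : IsNoetherian R R) K
    refine ⟨n, ?_⟩
    have hI (r : R) : r ∈ I ↔ r • y = 0 := by simp [I]
    rw [hI]
    by_contra hne
    obtain ⟨r, hr⟩ := hspan _ hne
    have h1 : r ∈ K (n + 1) := by
      simp only [K, OrderHom.coe_mk, Submodule.mem_colon_singleton, smul_eq_mul, hI]
      rw [pow_succ', mul_left_comm, mul_smul, mul_smul, hr]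
      exact (mem_m a).1 ha
    rw [← hn (n + 1) (by simp)] at h1
    simp only [K, OrderHom.coe_mk, Submodule.mem_colon_singleton, smul_eq_mul, hI] at h1
    rw [mul_smul, hr] at h1
    exact hx h1
  let S : Submodule R X := Submodule.torsionBySet R X m
  have mem_S (y : X) : y ∈ S ↔ ∀ a ∈ m, a • y = 0 := by
    simp [S, Submodule.mem_torsionBySet_iff]
  have hle (P Q : Submodule R X) (hQP : Q ≤ P)
      (hJ : reesAnnihilator m Q ≤ reesAnnihilator m P) : P ≤ Q := by
    have key (n : ℕ) : ∀ y ∈ P, (∀ a ∈ m ^ n, a • y = 0) → y ∈ Q := by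
      induction n with
      | zero =>
        intro y _ hy
        have : y = 0 := by simpa using hy 1 (by simp)
        simp [this]
      | succ n ih =>
        intro y hyP hy
        let T : Submodule R X := Submodule.torsionBySet R X (m ^ (n + 1) : Ideal R)
        have mem_T (y : X) : y ∈ T ↔ ∀ a ∈ m ^ (n + 1), a • y = 0 := by
          simp [T, Submodule.mem_torsionBySet_iff]
        let θ : T →ₗ[R] (m ^ n : Ideal R) →ₗ[R] S := LinearMap.mk₂ R
          (fun y a ↦ ⟨(a : R) • (y : X), (mem_S _).2 fun b hb ↦ by
            rw [smul_smul]
            exact (mem_T _).1 y.2 _ (by rw [pow_succ']; exact Ideal.mul_mem_mul hb a.2)⟩)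
          (fun _ _ _ ↦ by ext; simp) (fun _ _ _ ↦ Subtype.ext (smul_comm _ _ _))
          (fun _ _ _ ↦ by ext; simp [add_smul]) (fun _ _ _ ↦ by ext; simp [mul_smul])
        have hθ (y a) : (θ y a : X) = (a : R) • (y : X) := rfl
        have hmem := mem_of_iInf_ker_le_of_smul m (S := S)
          (fun y z hy0 ↦ by
            obtain ⟨r, hr⟩ := hsimple y z ((mem_S _).1 y.2) ((mem_S _).1 z.2) (by simpa using hy0)
            exact ⟨r, Subtype.ext hr⟩)
          (fun a ha y ↦ Subtype.ext ((mem_S _).1 y.2 a ha))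
          ((Q.comap T.subtype).map θ) (θ ⟨y, (mem_T _).2 hy⟩) (fun v hv ↦ by
            have hvQ : (⟨monomial n (v : R), reesAlgebra.monomial_mem.2 v.2⟩ : reesAlgebra m) ∈
                reesAnnihilator m Q := by
              intro k z hz hkz
              simp only [coeff_monomial]
              split_ifs with hk
              · subst hk
                have := hv _ (Submodule.mem_map_of_mem (f := θ)
                  (show (⟨z, (mem_T _).2 hkz⟩ : T) ∈ Q.comap T.subtype from hz))
                simpa [hθ] using congrArg Subtype.val this
              · simp
            have := hJ hvQ n y hyP hy
            exact Subtype.ext (by simpa [hθ] using this))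
        obtain ⟨q, hq, hqy⟩ := hmem
        have hqQ : (q : X) ∈ Q := hq
        have : y - q ∈ Q := ih _ (P.sub_mem hyP (hQP hqQ)) fun a ha ↦ by
          have := congrArg Subtype.val (LinearMap.congr_fun hqy ⟨a, ha⟩)
          rw [hθ, hθ] at this
          rw [smul_sub, sub_eq_zero]
          exact this.symm
        simpa using Q.add_mem this hqQ
    intro y hy
    obtain ⟨n, hn⟩ := htors y
    exact key n y hy hn
  have hanti : StrictAnti (reesAnnihilator m : Submodule R X → _) := fun Q P hlt ↦
    lt_of_le_not_ge (fun p hp n y hy ↦ hp n y (hlt.le hy)) fun hJ ↦ hlt.not_ge (hle P Q hlt.le hJ)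
  exact hanti.wellFoundedLT

end Matlis

section Purity
variable {R : Type u} [CommRing R] {M N : Type u} [AddCommGroup M] [Module R M]
  [AddCommGroup N] [Module R N]

/-- A finite linear system with constants in `M` that is solvable in `N` is solvable in `M`. -/
theorem IsPureMono.exists_solution {f : M →ₗ[R] N} (hf : IsPureMono R f) {ι κ : Type u}
    [Fintype ι] [Fintype κ] (r : κ → ι → R) (n : ι → N) (m : κ → M)
    (h : ∀ j, ∑ i, r j i • n i = f (m j)) : ∃ y : ι → M, ∀ j, ∑ i, r j i • y i = m j := by
  classical
  let K : Submodule R (κ → R) := Submodule.span R (Set.range fun i j ↦ r j i)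
  let e : κ → (κ → R) ⧸ K := fun j ↦ K.mkQ (Pi.single j 1)
  have sum_e (c : κ → R) : ∑ j, c j • e j = K.mkQ c := by
    simp only [e, ← map_smul, ← map_sum]
    congr 1
    exact (pi_eq_sum_univ' c).symm
  have he : Submodule.span R (Set.range e) = ⊤ := by
    rw [eq_top_iff]
    intro x _
    obtain ⟨c, rfl⟩ := K.mkQ_surjective x
    rw [← sum_e]
    exact Submodule.sum_mem _ fun j _ ↦ Submodule.smul_mem _ _ (Submodule.subset_span ⟨j, rfl⟩)
  have hzero : ∑ j, m j ⊗ₜ[R] e j = 0 := by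
    apply hf.2
    simp only [map_sum, LinearMap.rTensor_tmul, map_zero, ← h, sum_tmul, smul_tmul]
    rw [Finset.sum_comm]
    refine Finset.sum_eq_zero fun i _ ↦ ?_
    rw [← tmul_sum, sum_e, Submodule.mkQ_apply,
      (Submodule.Quotient.mk_eq_zero K).2 (Submodule.subset_span ⟨i, rfl⟩), tmul_zero]
  have hzero' : ∑ j, e j ⊗ₜ[R] m j = 0 := by
    simpa using congrArg (TensorProduct.comm R _ _) hzero
  obtain ⟨k, a, y, hay, ha⟩ := vanishesTrivially_of_sum_tmul_eq_zero R he hzero'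
  have hb (l : Fin k) : ∃ b : ι → R, ∑ i, b i • (fun j ↦ r j i) = fun j ↦ a j l := by
    rw [← Submodule.mem_span_range_iff_exists_fun, ← Submodule.Quotient.mk_eq_zero]
    have := ha l
    rwa [sum_e (fun j ↦ a j l)] at this
  choose b hb using hb
  refine ⟨fun i ↦ ∑ l, b l i • y l, fun j ↦ ?_⟩
  rw [hay j]
  simp only [Finset.smul_sum, smul_smul]
  rw [Finset.sum_comm]
  refine Finset.sum_congr rfl fun l _ ↦ ?_
  rw [← Finset.sum_smul, ← congrFun (hb l) j]
  simp [mul_comm]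

theorem IsPureMono.exists_retraction_of_fg [IsNoetherianRing R] {f : M →ₗ[R] N}
    (hf : IsPureMono R f) (F : Submodule R N) (hF : F.FG) :
    ∃ k : F →ₗ[R] M, ∀ m (hm : f m ∈ F), k ⟨f m, hm⟩ = m := by
  classical
  obtain ⟨p, n, rfl⟩ := Submodule.fg_iff_exists_fin_generating_family.1 hF
  let φ : (Fin p → R) →ₗ[R] N := Fintype.linearCombination R n
  have hφ (c) : φ c = ∑ i, c i • n i := rfl
  obtain ⟨q, r, hr⟩ := Submodule.fg_iff_exists_fin_generating_family.1
    (IsNoetherian.noetherian ((LinearMap.range f).comap φ))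
  have hmem (j : Fin q) : ∃ m, f m = φ (r j) := by
    have : r j ∈ (LinearMap.range f).comap φ := hr ▸ Submodule.subset_span ⟨j, rfl⟩
    exact this
  choose m hm using hmem
  obtain ⟨y, hy⟩ := hf.exists_solution (ι := ULift (Fin p)) (κ := ULift (Fin q))
    (fun j i ↦ r j.down i.down) (fun i ↦ n i.down) (fun j ↦ m j.down) (fun j ↦ by
      rw [hm, hφ]
      exact Equiv.ulift.sum_comp (fun i ↦ r j.down i • n i))
  let ψ : (Fin p → R) →ₗ[R] M := Fintype.linearCombination R (fun i ↦ y ⟨i⟩)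
  have hψr (j) : ψ (r j) = m j := by
    rw [← hy ⟨j⟩]
    exact (Equiv.ulift.sum_comp (fun i ↦ r j i • y ⟨i⟩)).symm
  have key (c : Fin p → R) (x : M) (hx : f x = φ c) : ψ c = x := by
    have hc : c ∈ (LinearMap.range f).comap φ := ⟨x, hx⟩
    rw [← hr] at hc
    obtain ⟨d, rfl⟩ := Submodule.mem_span_range_iff_exists_fun R |>.1 hc
    apply hf.1
    rw [hx]
    simp [hψr, hm]
  have hrange : LinearMap.range φ = Submodule.span R (Set.range n) :=
    Fintype.range_linearCombination R n
  rw [← hrange]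
  have hker : LinearMap.ker φ.rangeRestrict ≤ LinearMap.ker ψ := fun c hc ↦
    key c 0 (by rw [LinearMap.ker_rangeRestrict] at hc; simpa using hc.symm)
  refine ⟨(LinearMap.ker φ.rangeRestrict).liftQ ψ hker ∘ₗ
    (φ.rangeRestrict.quotKerEquivOfSurjective φ.surjective_rangeRestrict).symm.toLinearMap,
    fun x hx ↦ ?_⟩
  obtain ⟨c, hc⟩ := hx
  have : (φ.rangeRestrict.quotKerEquivOfSurjective φ.surjective_rangeRestrict).symm
      ⟨f x, c, hc⟩ = Submodule.Quotient.mk c := by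
    rw [LinearEquiv.symm_apply_eq]
    exact Subtype.ext hc.symm
  simp only [LinearMap.comp_apply, LinearEquiv.coe_coe, this, Submodule.liftQ_apply]
  exact key c x hc.symm

theorem isPureMono_of_forall_finite {f : M →ₗ[R] N}
    (h : ∀ (L : Type u) [AddCommGroup L] [Module R L] [Module.Finite R L],
      Function.Injective (f.rTensor L)) : IsPureMono R f := by
  have hall (L : Type u) [AddCommGroup L] [Module R L] : Function.Injective (f.lTensor L) := by
    rw [injective_iff_map_eq_zero]
    intro x hx
    obtain ⟨P, hP, t, rfl⟩ := TensorProduct.exists_of_fg x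
    rw [← LinearMap.comp_apply, LinearMap.lTensor_comp_rTensor, ← LinearMap.rTensor_comp_lTensor,
      LinearMap.comp_apply] at hx
    obtain ⟨Q, hPQ, hQ, h0⟩ := TensorProduct.eq_zero_of_fg_of_subtype_eq_zero hP hx
    rw [← LinearMap.comp_apply, LinearMap.rTensor_comp_lTensor, ← LinearMap.lTensor_comp_rTensor,
      LinearMap.comp_apply] at h0
    have : Module.Finite R Q := Module.Finite.iff_fg.2 hQ
    have := (injective_iff_map_eq_zero _).1
      ((LinearMap.lTensor_inj_iff_rTensor_inj _ f).2 (h Q)) _ h0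
    rw [← Submodule.subtype_comp_inclusion _ _ hPQ, LinearMap.rTensor_comp, LinearMap.comp_apply,
      this, map_zero]
  refine ⟨fun x y hxy ↦ ?_, fun L _ _ ↦ (LinearMap.lTensor_inj_iff_rTensor_inj _ f).1 (hall L)⟩
  apply (TensorProduct.lid R M).symm.injective
  apply hall R
  simp [hxy]

theorem isArtinian_linearMap {L A : Type*} [AddCommGroup L] [Module R L] [Module.Finite R L]
    [AddCommGroup A] [Module R A] [IsArtinian R A] : IsArtinian R (L →ₗ[R] A) := by
  obtain ⟨n, φ, hφ⟩ := Module.Finite.exists_fin' R L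
  let ψ : (L →ₗ[R] A) →ₗ[R] (Fin n → A) :=
    LinearMap.pi fun j ↦ LinearMap.applyₗ (φ (Pi.single j 1))
  refine isArtinian_of_injective ψ fun a b hab ↦ ?_
  rw [← LinearMap.cancel_right hφ]
  exact LinearMap.pi_ext' fun j ↦ LinearMap.ext_ring (congrFun hab j)

theorem exists_isArtinian_quotient_notMem [IsNoetherianRing R] {x : M} (hx : x ≠ 0) :
    ∃ W : Submodule R M, x ∉ W ∧ IsArtinian R (M ⧸ W) := by
  obtain ⟨W, -, hW⟩ := zorn_le_nonempty₀ {W : Submodule R M | x ∉ W}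
    (fun c hc hchain W hWc ↦ ⟨sSup c, fun hmem ↦ by
      obtain ⟨V, hV, hxV⟩ := (Submodule.mem_sSup_of_directed ⟨W, hWc⟩ hchain.directedOn).1 hmem
      exact hc hV hxV, fun V hV ↦ le_sSup hV⟩) ⊥ (by simpa using hx)
  have hxW : x ∉ W := hW.prop
  refine ⟨W, hxW, isArtinian_of_forall_mem (x := W.mkQ x) (by simpa using hxW) fun P hP ↦ ?_⟩
  by_contra hxP
  have hle := hW.le_of_ge (y := P.comap W.mkQ) hxP
    (fun w hw ↦ by simp [(Submodule.Quotient.mk_eq_zero W).2 hw])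
  refine hP (eq_bot_iff.2 fun y hy ↦ ?_)
  obtain ⟨y, rfl⟩ := W.mkQ_surjective y
  simpa using hle hy

theorem exists_isArtinian_quotient_rTensor_ne_zero [IsNoetherianRing R] {L : Type u}
    [AddCommGroup L] [Module R L] [Module.Finite R L] {x : M ⊗[R] L} (hx : x ≠ 0) :
    ∃ W : Submodule R M, IsArtinian R (M ⧸ W) ∧ W.mkQ.rTensor L x ≠ 0 := by
  obtain ⟨V, hxV, hV⟩ := exists_isArtinian_quotient_notMem (R := R) hx
  let t : M →ₗ[R] L →ₗ[R] (M ⊗[R] L) ⧸ V := (TensorProduct.mk R M L).compr₂ V.mkQ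
  have : IsArtinian R (L →ₗ[R] (M ⊗[R] L) ⧸ V) := isArtinian_linearMap
  let s := (LinearMap.ker t).liftQ t le_rfl
  refine ⟨LinearMap.ker t, isArtinian_of_injective s
    (LinearMap.ker_eq_bot.1 (Submodule.ker_liftQ_eq_bot' _ _ rfl)), fun h0 ↦ hxV ?_⟩
  have hlift : TensorProduct.lift s ∘ₗ (LinearMap.ker t).mkQ.rTensor L = V.mkQ :=
    TensorProduct.ext' fun _ _ ↦ rfl
  have := LinearMap.congr_fun hlift x
  rw [LinearMap.comp_apply, h0, map_zero] at this
  exact (Submodule.Quotient.mk_eq_zero V).1 this.symm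

theorem isPureMono_pi {ι : Type u} {A : ι → Type u} [∀ i, AddCommGroup (A i)]
    [∀ i, Module R (A i)] (f : ∀ i, M →ₗ[R] A i)
    (h : ∀ (L : Type u) [AddCommGroup L] [Module R L] [Module.Finite R L] (x : M ⊗[R] L),
      x ≠ 0 → ∃ i, (f i).rTensor L x ≠ 0) : IsPureMono R (LinearMap.pi f) := by
  refine isPureMono_of_forall_finite fun L _ _ _ ↦ (injective_iff_map_eq_zero _).2 fun x hx ↦ ?_
  by_contra hx0
  obtain ⟨i, hi⟩ := h L x hx0
  rw [← LinearMap.proj_pi f i, LinearMap.rTensor_comp, LinearMap.comp_apply, hx, map_zero] at hi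
  exact hi rfl

variable (R M) in
/-- The canonical map from `M` to the product of all its Artinian quotients. -/
def toPiArtinianQuotient :
    M →ₗ[R] ∀ W : {W : Submodule R M // IsArtinian R (M ⧸ W)}, M ⧸ W.1 :=
  LinearMap.pi fun W ↦ W.1.mkQ

theorem isPureMono_toPiArtinianQuotient [IsNoetherianRing R] :
    IsPureMono R (toPiArtinianQuotient R M) :=
  isPureMono_pi _ fun _ _ _ _ _ hx ↦
    have ⟨W, hW, hxW⟩ := exists_isArtinian_quotient_rTensor_ne_zero hx
    ⟨⟨W, hW⟩, hxW⟩

/-- A submodule of `N × A`, regarded as a partial map from `N` to `A`, is finitely extendable if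
on each finitely generated submodule of `N` it agrees with some linear map to `A`. -/
def FinitelyExtendable {A : Type*} [AddCommGroup A] [Module R A] (G : Submodule R (N × A)) : Prop :=
  ∀ F : Submodule R N, F.FG → ∃ k : F →ₗ[R] A, ∀ y (hy : y ∈ F) a, (y, a) ∈ G → k ⟨y, hy⟩ = a

namespace FinitelyExtendable

variable {A : Type*} [AddCommGroup A] [Module R A] {G : Submodule R (N × A)}

theorem eq_of_mem (hG : FinitelyExtendable G) {y : N} {a b : A} (ha : (y, a) ∈ G)
    (hb : (y, b) ∈ G) : a = b := by
  obtain ⟨k, hk⟩ := hG _ (Submodule.fg_span_singleton y)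
  have hy := Submodule.mem_span_singleton_self (R := R) y
  rw [← hk y hy a ha, hk y hy b hb]

theorem sSup_of_isChain [IsNoetherianRing R] {c : Set (Submodule R (N × A))}
    (hc : ∀ G ∈ c, FinitelyExtendable G) (hchain : IsChain (· ≤ ·) c) (hne : c.Nonempty) :
    FinitelyExtendable (sSup c) := by
  intro F hF
  have : IsNoetherian R F := isNoetherian_of_fg_of_noetherian F hF
  let dom (G : Submodule R (N × A)) : Submodule R F :=
    (G.map (LinearMap.fst R N A)).comap F.subtype
  have hdom (G : Submodule R (N × A)) (y : F) : y ∈ dom G ↔ ∃ a, ((y : N), a) ∈ G := by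
    simp [dom]
  obtain ⟨_, ⟨G, hG, rfl⟩, hmax⟩ := set_has_maximal_iff_noetherian.2 this (dom '' c)
    (hne.image _)
  obtain ⟨k, hk⟩ := hc G hG F hF
  refine ⟨k, fun y hy a ha ↦ ?_⟩
  obtain ⟨G', hG', haG'⟩ := (Submodule.mem_sSup_of_directed hne hchain.directedOn).1 ha
  obtain hle | hle := hchain.total hG' hG
  · exact hk y hy a (hle haG')
  have hdle : dom G ≤ dom G' := Submodule.comap_mono (Submodule.map_mono hle)
  have hdeq : dom G = dom G' :=
    by_contra fun hne ↦ hmax _ ⟨G', hG', rfl⟩ (lt_of_le_of_ne hdle hne)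
  have : (⟨y, hy⟩ : F) ∈ dom G := hdeq ▸ (hdom _ _).2 ⟨a, haG'⟩
  obtain ⟨b, hb⟩ := (hdom _ _).1 this
  rw [hk y hy b hb, (hc G' hG').eq_of_mem haG' (hle hb)]

theorem exists_value [IsArtinian R A] (hG : FinitelyExtendable G) (n : N) :
    ∃ a : A, ∀ F : Submodule R N, F.FG → ∀ hn : n ∈ F,
      ∃ k : F →ₗ[R] A, (∀ y (hy : y ∈ F) a, (y, a) ∈ G → k ⟨y, hy⟩ = a) ∧ k ⟨n, hn⟩ = a := by
  let Z (F : Submodule R N) : Submodule R (F →ₗ[R] A) :=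
    { carrier := {k | ∀ y (hy : y ∈ F) a, (y, a) ∈ G → k ⟨y, hy⟩ = 0}
      add_mem' := fun hk hl y hy a ha ↦ by simp [hk y hy a ha, hl y hy a ha]
      zero_mem' := fun _ _ _ _ ↦ rfl
      smul_mem' := fun r k hk y hy a ha ↦ by simp [hk y hy a ha] }
  let U (F : {F : Submodule R N // F.FG ∧ n ∈ F}) : Submodule R A :=
    (Z F.1).map (LinearMap.applyₗ (⟨n, F.2.2⟩ : F.1))
  obtain ⟨_, ⟨F₀, rfl⟩, hmin⟩ := IsArtinian.set_has_minimal (Set.range U)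
    ⟨_, ⟨Submodule.span R {n}, Submodule.fg_span_singleton n,
      Submodule.mem_span_singleton_self n⟩, rfl⟩
  obtain ⟨k₀, hk₀⟩ := hG F₀ F₀.2.1
  refine ⟨k₀ ⟨n, F₀.2.2⟩, fun F hF hn ↦ ?_⟩
  let F₁ : {F : Submodule R N // F.FG ∧ n ∈ F} :=
    ⟨F₀.1 ⊔ F, F₀.2.1.sup hF, Submodule.mem_sup_right hn⟩
  have h₀ : F₀.1 ≤ F₁.1 := le_sup_left
  have h₁ : F ≤ F₁.1 := le_sup_right
  have hle : U F₁ ≤ U F₀ := by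
    rintro _ ⟨k, hk, rfl⟩
    exact ⟨k ∘ₗ Submodule.inclusion h₀, fun y hy a ha ↦ hk y (h₀ hy) a ha, rfl⟩
  have heq : U F₁ = U F₀ := by_contra fun hne ↦ hmin _ ⟨F₁, rfl⟩ (lt_of_le_of_ne hle hne)
  obtain ⟨k₁, hk₁⟩ := hG F₁ F₁.2.1
  have hmem : k₀ ⟨n, F₀.2.2⟩ - k₁ ⟨n, F₁.2.2⟩ ∈ U F₀ :=
    ⟨k₀ - k₁ ∘ₗ Submodule.inclusion h₀, fun y hy a ha ↦ by
      simp [Submodule.inclusion_apply, hk₀ y hy a ha, hk₁ y (h₀ hy) a ha], rfl⟩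
  rw [← heq] at hmem
  obtain ⟨u, hu, hun⟩ := hmem
  replace hun : u ⟨n, F₁.2.2⟩ = k₀ ⟨n, F₀.2.2⟩ - k₁ ⟨n, F₁.2.2⟩ := hun
  refine ⟨(k₁ + u) ∘ₗ Submodule.inclusion h₁, fun y hy a ha ↦ ?_, ?_⟩
  · simp [Submodule.inclusion_apply, hk₁ y (h₁ hy) a ha, hu y (h₁ hy) a ha]
  · simp [Submodule.inclusion_apply, hun]

theorem exists_extension [IsNoetherianRing R] [IsArtinian R A] (hG : FinitelyExtendable G) :
    ∃ h : N →ₗ[R] A, ∀ y a, (y, a) ∈ G → h y = a := by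
  obtain ⟨H, hGH, hmax⟩ := zorn_le_nonempty₀ {G : Submodule R (N × A) | FinitelyExtendable G}
    (fun c hc hchain G hGc ↦ ⟨sSup c, sSup_of_isChain hc hchain ⟨G, hGc⟩,
      fun _ hV ↦ le_sSup hV⟩) G hG
  have hH : FinitelyExtendable H := hmax.prop
  have htotal (n : N) : ∃ a, (n, a) ∈ H := by
    obtain ⟨a, ha⟩ := hH.exists_value n
    refine ⟨a, hmax.le_of_ge (y := H ⊔ Submodule.span R {(n, a)}) (fun F hF ↦ ?_) le_sup_left
      (Submodule.mem_sup_right (Submodule.mem_span_singleton_self _))⟩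
    have hn : n ∈ F ⊔ Submodule.span R {n} :=
      Submodule.mem_sup_right (Submodule.mem_span_singleton_self _)
    obtain ⟨k, hk, hkn⟩ := ha (F ⊔ Submodule.span R {n}) (hF.sup (Submodule.fg_span_singleton n)) hn
    refine ⟨k ∘ₗ Submodule.inclusion le_sup_left, fun y hy b hb ↦ ?_⟩
    obtain ⟨⟨y', b'⟩, hyb, z, hz, hsum⟩ := Submodule.mem_sup.1 hb
    obtain ⟨r, rfl⟩ := Submodule.mem_span_singleton.1 hz
    simp only [Prod.smul_mk, Prod.mk_add_mk, Prod.mk.injEq] at hsum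
    obtain ⟨rfl, rfl⟩ := hsum
    have hy' : y' ∈ F ⊔ Submodule.span R {n} := by
      simpa using Submodule.sub_mem _ (Submodule.mem_sup_left hy) (Submodule.smul_mem _ r hn)
    rw [← hk y' hy' b' hyb, ← hkn, ← map_smul, ← map_add]
    rfl
  choose h hh using htotal
  exact ⟨{ toFun := h
           map_add' := fun x y ↦ hH.eq_of_mem (hh _) (H.add_mem (hh x) (hh y))
           map_smul' := fun r x ↦ hH.eq_of_mem (hh _) (H.smul_mem r (hh x)) },
    fun y a hya ↦ hH.eq_of_mem (hh y) (hGH hya)⟩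

end FinitelyExtendable

theorem IsPureMono.exists_extension_of_isArtinian [IsNoetherianRing R] {f : M →ₗ[R] N}
    (hf : IsPureMono R f) {A : Type*} [AddCommGroup A] [Module R A] [IsArtinian R A]
    (g : M →ₗ[R] A) : ∃ h : N →ₗ[R] A, h ∘ₗ f = g := by
  have hG : FinitelyExtendable (LinearMap.range (f.prod g)) := fun F hF ↦ by
    obtain ⟨k, hk⟩ := hf.exists_retraction_of_fg F hF
    refine ⟨g ∘ₗ k, fun y hy a ⟨m, hm⟩ ↦ ?_⟩
    obtain ⟨rfl, rfl⟩ := Prod.mk.inj hm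
    rw [LinearMap.comp_apply, hk]
  obtain ⟨h, hh⟩ := hG.exists_extension
  exact ⟨h, LinearMap.ext fun m ↦ hh _ _ ⟨m, rfl⟩⟩

end Purity

theorem pureInjective_iff_summand_prod_artinian (R : Type u) [CommRing R]
    [IsNoetherianRing R] (D : Type u) [AddCommGroup D] [Module R D] :
    IsPureInjective R D ↔
      ∃ (ι : Type u) (A : ι → ModuleCat.{u} R), (∀ i, IsArtinian R (A i)) ∧
        ∃ (f : D →ₗ[R] ∀ i, A i) (g : (∀ i, A i) →ₗ[R] D), g ∘ₗ f = LinearMap.id := by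
  constructor
  · intro hD
    exact ⟨{W : Submodule R D // IsArtinian R (D ⧸ W)}, fun W ↦ ModuleCat.of R (D ⧸ W.1),
      fun W ↦ W.2, toPiArtinianQuotient R D,
      hD D _ (toPiArtinianQuotient R D) isPureMono_toPiArtinianQuotient LinearMap.id⟩
  · rintro ⟨ι, A, hA, f, g, hgf⟩ M N _ _ _ _ j hj φ
    choose h hh using fun i ↦ hj.exists_extension_of_isArtinian (LinearMap.proj i ∘ₗ f ∘ₗ φ)
    refine ⟨g ∘ₗ LinearMap.pi h, ?_⟩
    have : LinearMap.pi h ∘ₗ j = f ∘ₗ φ :=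
      LinearMap.ext fun m ↦ funext fun i ↦ LinearMap.congr_fun (hh i) m
    rw [LinearMap.comp_assoc, this, ← LinearMap.comp_assoc, hgf, LinearMap.id_comp]
end

section
/- Let (R, m) be a Noetherian complete local ring that is not Artinian. Then R is a pure injective R-module, but R is not isomorphic to a direct product of any family of Artinian R-modules. -/
universe u

open TensorProduct IsLocalRing

/-- The quotients of a Noetherian local ring by powers of its maximal ideal are Artinian. -/
lemma isArtinian_quotient_maximalIdeal_pow (R : Type*) [CommRing R] [IsNoetherianRing R]
    [IsLocalRing R] (n : ℕ) : IsArtinian R (R ⧸ maximalIdeal R ^ n) := by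
  rcases subsingleton_or_nontrivial (R ⧸ maximalIdeal R ^ n) with h | h
  · infer_instance
  · have hs : Function.Surjective (Ideal.Quotient.mk (maximalIdeal R ^ n)) :=
      Ideal.Quotient.mk_surjective
    have : IsLocalRing (R ⧸ maximalIdeal R ^ n) := .of_surjective' _ hs
    have hA : IsArtinianRing (R ⧸ maximalIdeal R ^ n) := by
      rw [isArtinianRing_iff_isNilpotent_maximalIdeal, ← map_maximalIdeal_of_surjective _ hs]
      exact ⟨n, by rw [← Ideal.map_pow, Ideal.map_quotient_self, Ideal.zero_eq_bot]⟩
    exact isArtinian_of_surjective_algebraMap (S := R) (R := R ⧸ maximalIdeal R ^ n) hs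

/-- Ideals of a Noetherian local ring are closed in the adic topology of the maximal ideal. -/
lemma mem_of_forall_mem_sup_maximalIdeal_pow {R : Type*} [CommRing R] [IsNoetherianRing R]
    [IsLocalRing R] {I : Ideal R} {x : R} (h : ∀ n : ℕ, x ∈ I ⊔ maximalIdeal R ^ n) : x ∈ I := by
  have hH : IsHausdorff (maximalIdeal R) (R ⧸ I) := inferInstance
  rw [← Ideal.Quotient.eq_zero_iff_mem]
  refine hH.haus _ fun n ↦ SModEq.sub_mem.2 ?_
  obtain ⟨y, hy, z, hz, rfl⟩ := Submodule.mem_sup.1 (h n)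
  have hzn : z • (1 : R ⧸ I) ∈ (maximalIdeal R ^ n • ⊤ : Submodule R (R ⧸ I)) :=
    Submodule.smul_mem_smul hz trivial
  rw [map_add, Ideal.Quotient.eq_zero_iff_mem.2 hy, zero_add, sub_zero]
  rwa [Algebra.smul_def, mul_one] at hzn

/-- Complete Noetherian local rings are linearly compact: a directed family of nonempty cosets of
ideals has a common point. -/
lemma exists_mem_of_directed_cosets {R : Type*} [CommRing R] [IsNoetherianRing R]
    [IsLocalRing R] [IsAdicComplete (maximalIdeal R) R] {ι : Type*} [Preorder ι]
    [IsDirected ι (· ≤ ·)] [Nonempty ι] (C : ι → Set R) (I : ι → Ideal R) (hC : Antitone C)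
    (hne : ∀ i, (C i).Nonempty) (hI : ∀ i, ∀ a ∈ C i, ∀ b, b ∈ C i ↔ b - a ∈ I i) :
    ∃ r, ∀ i, r ∈ C i := by
  have hIanti : Antitone I := fun i j hij x hx ↦ by
    obtain ⟨a, ha⟩ := hne j
    have hxa := hC hij ((hI j a ha (x + a)).2 (by simpa using hx))
    simpa using (hI i a (hC hij ha) _).1 hxa
  let Stable (n : ℕ) (i : ι) : Prop := ∀ j, i ≤ j → I i ≤ I j ⊔ maximalIdeal R ^ n
  have stable_mono {n i j} (hi : Stable n i) (hij : i ≤ j) : Stable n j :=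
    fun k hk ↦ (hIanti hij).trans (hi k (hij.trans hk))
  have exists_stable (n : ℕ) : ∃ i, Stable n i := by
    have := isArtinian_quotient_maximalIdeal_pow R n
    obtain ⟨_, ⟨i, rfl⟩, hi⟩ := IsArtinian.set_has_minimal
      (Set.range fun i ↦ Submodule.map (maximalIdeal R ^ n).mkQ (I i)) (Set.range_nonempty _)
    refine ⟨i, fun j hij ↦ ?_⟩
    have hle := Submodule.map_mono (f := (maximalIdeal R ^ n).mkQ) (hIanti hij)
    have heq := eq_of_le_of_not_lt hle (hi _ ⟨j, rfl⟩)
    have hcomap := (Submodule.map_le_iff_le_comap).1 heq.ge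
    rwa [Submodule.comap_map_mkQ, sup_comm] at hcomap
  have start : ∃ p : ι × R, p.2 ∈ C p.1 ∧ Stable 0 p.1 := by
    obtain ⟨i, hi⟩ := exists_stable 0
    obtain ⟨a, ha⟩ := hne i
    exact ⟨(i, a), ha, hi⟩
  have step (n : ℕ) (p : {p : ι × R // p.2 ∈ C p.1 ∧ Stable n p.1}) :
      ∃ q : {p : ι × R // p.2 ∈ C p.1 ∧ Stable (n + 1) p.1},
        q.1.2 - p.1.2 ∈ maximalIdeal R ^ n := by
    obtain ⟨⟨i, a⟩, ha, hi⟩ := p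
    obtain ⟨j, hj⟩ := exists_stable (n + 1)
    obtain ⟨k, hik, hjk⟩ := directed_of (· ≤ ·) i j
    obtain ⟨b, hb⟩ := hne k
    obtain ⟨y, hy, z, hz, hyz⟩ :=
      Submodule.mem_sup.1 (hi k hik ((hI i a ha b).1 (hC hik hb)))
    refine ⟨⟨(k, b - y), (hI k b hb _).2 (by simpa using hy), stable_mono hj hjk⟩, ?_⟩
    have : b - y - a = z := by linear_combination -hyz
    simpa [this] using hz
  choose next hnext using step
  let s (n : ℕ) : {p : ι × R // p.2 ∈ C p.1 ∧ Stable n p.1} :=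
    Nat.rec ⟨start.choose, start.choose_spec⟩ next n
  have hs (n : ℕ) : (s (n + 1)).1.2 - (s n).1.2 ∈ maximalIdeal R ^ n := hnext n (s n)
  have hcauchy {m n : ℕ} (hmn : m ≤ n) :
      (s m).1.2 ≡ (s n).1.2 [SMOD (maximalIdeal R ^ m • ⊤ : Submodule R R)] := by
    rw [SModEq.comm, SModEq.sub_mem, smul_eq_mul, Ideal.mul_top]
    induction n, hmn using Nat.le_induction with
    | base => simp
    | succ n hmn ih =>
      rw [← sub_add_sub_cancel _ (s n).1.2]
      exact add_mem (Ideal.pow_le_pow_right hmn (hs n)) ih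
  obtain ⟨r, hr⟩ := IsPrecomplete.prec (I := maximalIdeal R) inferInstance hcauchy
  refine ⟨r, fun j ↦ ?_⟩
  obtain ⟨c, hc⟩ := hne j
  refine (hI j c hc r).2 (mem_of_forall_mem_sup_maximalIdeal_pow fun n ↦ ?_)
  have hrn := hr n
  rw [SModEq.comm, SModEq.sub_mem, smul_eq_mul, Ideal.mul_top] at hrn
  generalize s n = p at hrn
  obtain ⟨⟨i, a⟩, ha, hi⟩ := p
  obtain ⟨k, hik, hjk⟩ := directed_of (· ≤ ·) i j
  obtain ⟨d, hd⟩ := hne k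
  have h₁ : d - a ∈ I j ⊔ maximalIdeal R ^ n :=
    sup_le_sup_right (hIanti hjk) _ (hi k hik ((hI i a ha d).1 (hC hik hd)))
  have h₂ : d - c ∈ I j ⊔ maximalIdeal R ^ n :=
    Ideal.mem_sup_left ((hI j c hc d).1 (hC hjk hd))
  have : r - c = (r - a) - (d - a) + (d - c) := by ring
  rw [this]
  exact add_mem (sub_mem (Ideal.mem_sup_right hrn) h₁) h₂

/-- Along a pure monomorphism, finitely many equations that hold in the larger module can be
solved in the smaller one. -/
lemma IsPureMono.exists_linearMap {R : Type u} [CommRing R] {M N : Type u} [AddCommGroup M]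
    [Module R M] [AddCommGroup N] [Module R N] {f : M →ₗ[R] N} (hf : IsPureMono R f)
    {κ : Type*} (π : (κ →₀ R) →ₗ[R] N) {ι : Type u} [Finite ι] (x : ι → κ →₀ R) (m : ι → M)
    (h : ∀ i, π (x i) = f (m i)) : ∃ φ : (κ →₀ R) →ₗ[R] M, ∀ i, φ (x i) = m i := by
  classical
  have := Fintype.ofFinite ι
  let K : Submodule R (ι → R) :=
    LinearMap.range (LinearMap.pi fun i ↦ LinearMap.applyₗ (x i) :
      ((κ →₀ R) →ₗ[R] R) →ₗ[R] ι → R)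
  let e (i : ι) : (ι → R) ⧸ K := K.mkQ (Pi.single i 1)
  have hP : ∑ i, x i ⊗ₜ[R] e i = 0 := by
    apply (finsuppScalarLeft R ((ι → R) ⧸ K) κ).injective
    ext k
    rw [map_sum, Finsupp.finsetSum_apply, map_zero, Finsupp.zero_apply]
    simp only [finsuppScalarLeft_apply_tmul_apply, e]
    simp only [← map_smul, ← map_sum]
    rw [Submodule.mkQ_apply, Submodule.Quotient.mk_eq_zero]
    refine ⟨Finsupp.lapply k, ?_⟩
    ext i
    simp [Finset.sum_apply, Pi.single_apply]
  have hN : ∑ i, f (m i) ⊗ₜ[R] e i = 0 := by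
    simpa [h] using congrArg (LinearMap.rTensor ((ι → R) ⧸ K) π) hP
  have hM : ∑ i, m i ⊗ₜ[R] e i = 0 := hf.2 _ (by simpa using hN)
  obtain ⟨t, ht⟩ := (lTensor_exact M (LinearMap.exact_subtype_mkQ K) K.mkQ_surjective
    (∑ i, m i ⊗ₜ[R] Pi.single i 1)).1 (by simpa [e] using hM)
  have key (t : M ⊗[R] K) : ∃ φ : (κ →₀ R) →ₗ[R] M,
      ∀ i, φ (x i) = piScalarRight R R M ι (K.subtype.lTensor M t) i := by
    induction t with
    | zero => exact ⟨0, by simp⟩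
    | tmul a k =>
      obtain ⟨_, ψ, rfl⟩ := k
      exact ⟨ψ.smulRight a, by simp⟩
    | add s t hs ht =>
      obtain ⟨φ, hφ⟩ := hs
      obtain ⟨ψ, hψ⟩ := ht
      exact ⟨φ + ψ, fun i ↦ by simp only [LinearMap.add_apply, hφ, hψ, map_add, Pi.add_apply]⟩
  obtain ⟨φ, hφ⟩ := key t
  refine ⟨φ, fun i ↦ ?_⟩
  rw [hφ, ht]
  simp [Finset.sum_apply, Pi.single_apply]

/-- Linear compactness principle: prescribed values for a linear functional which are finitely
consistent are consistent. -/
lemma exists_linearMap_of_finitely_consistent {R : Type*} [CommRing R] [IsNoetherianRing R]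
    [IsLocalRing R] [IsAdicComplete (maximalIdeal R) R] {P : Type*} [AddCommGroup P] [Module R P]
    (S : Set (P × R))
    (hS : ∀ F : Finset (P × R), (F : Set (P × R)) ⊆ S → ∃ φ : P →ₗ[R] R, ∀ y ∈ F, φ y.1 = y.2) :
    ∃ φ : P →ₗ[R] R, ∀ y ∈ S, φ y.1 = y.2 := by
  classical
  obtain ⟨T, hST, hT⟩ := zorn_subset_nonempty
    {T : Set (P × R) | ∀ F : Finset (P × R), (F : Set (P × R)) ⊆ T →
      ∃ φ : P →ₗ[R] R, ∀ y ∈ F, φ y.1 = y.2}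
    (fun c hc hchain hne ↦ ⟨⋃₀ c, fun F hF ↦ by
      obtain ⟨t, htc, hFt⟩ := hchain.directedOn.exists_mem_subset_of_finset_subset_biUnion
        (f := id) hne (by simpa [Set.sUnion_eq_biUnion] using hF)
      exact hc htc F hFt, fun _ ↦ Set.subset_sUnion_of_mem⟩) S hS
  have total (x : P) : ∃ r, (x, r) ∈ T := by
    let Solves (F : Finset T) (φ : P →ₗ[R] R) : Prop := ∀ y ∈ F, φ y.1.1 = y.1.2
    have hsolv (F : Finset T) : ∃ φ, Solves F φ := by
      obtain ⟨φ, hφ⟩ := hT.prop (F.map (Function.Embedding.subtype _)) (by simp)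
      exact ⟨φ, fun y hy ↦ hφ y (Finset.mem_map_of_mem _ hy)⟩
    let I (F : Finset T) : Ideal R :=
      { carrier := {r | ∃ φ : P →ₗ[R] R, (∀ y ∈ F, φ y.1.1 = 0) ∧ φ x = r}
        zero_mem' := ⟨0, by simp⟩
        add_mem' := by
          rintro _ _ ⟨φ, hφ, rfl⟩ ⟨ψ, hψ, rfl⟩
          exact ⟨φ + ψ, fun y hy ↦ by simp [hφ y hy, hψ y hy], rfl⟩
        smul_mem' := by
          rintro c _ ⟨φ, hφ, rfl⟩
          exact ⟨c • φ, fun y hy ↦ by simp [hφ y hy], rfl⟩ }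
    obtain ⟨r, hr⟩ := exists_mem_of_directed_cosets
      (fun F : Finset T ↦ {r | ∃ φ, Solves F φ ∧ φ x = r}) I
      (fun F G hFG r ⟨φ, hφ, hr⟩ ↦ ⟨φ, fun y hy ↦ hφ y (Finset.mem_of_subset hFG hy), hr⟩)
      (fun F ↦ (hsolv F).imp' (fun φ ↦ φ x) fun φ hφ ↦ ⟨φ, hφ, rfl⟩)
      (by
        rintro F _ ⟨φ, hφ, rfl⟩ b
        constructor
        · rintro ⟨ψ, hψ, rfl⟩
          exact ⟨ψ - φ, fun y hy ↦ by simp [hφ y hy, hψ y hy], rfl⟩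
        · rintro ⟨ψ, hψ, hb⟩
          exact ⟨ψ + φ, fun y hy ↦ by simp [hφ y hy, hψ y hy], by simp [hb]⟩)
    refine ⟨r, hT.le_of_ge (y := insert (x, r) T) ?_ (Set.subset_insert _ _)
      (Set.mem_insert _ _)⟩
    intro F hF
    obtain ⟨φ, hφ, hx⟩ := hr (F.subtype (· ∈ T))
    refine ⟨φ, fun y hy ↦ ?_⟩
    rcases hF hy with rfl | hyT
    · exact hx
    · exact hφ ⟨y, hyT⟩ (by simpa using hy)
  choose v hv using total
  have consistent (F : Finset (P × R)) (hF : (F : Set (P × R)) ⊆ T) := hT.prop F hF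
  refine ⟨{ toFun := v, map_add' := fun x y ↦ ?_, map_smul' := fun c x ↦ ?_ }, fun y hy ↦ ?_⟩
  · obtain ⟨φ, hφ⟩ := consistent {(x, v x), (y, v y), (x + y, v (x + y))}
      (by simp [Set.insert_subset_iff, hv])
    simp only [Finset.mem_insert, Finset.mem_singleton, forall_eq_or_imp, forall_eq] at hφ
    rw [← hφ.1, ← hφ.2.1, ← hφ.2.2, map_add]
  · obtain ⟨φ, hφ⟩ := consistent {(x, v x), (c • x, v (c • x))}
      (by simp [Set.insert_subset_iff, hv])
    simp only [Finset.mem_insert, Finset.mem_singleton, forall_eq_or_imp, forall_eq] at hφ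
    rw [← hφ.1, ← hφ.2, map_smul, RingHom.id_apply]
  · obtain ⟨φ, hφ⟩ := consistent {y, (y.1, v y.1)}
      (by simp [Set.insert_subset_iff, hv, hST hy])
    simp only [Finset.mem_insert, Finset.mem_singleton, forall_eq_or_imp, forall_eq] at hφ
    exact hφ.2.symm.trans hφ.1

/-- A complete Noetherian local ring is pure injective as a module over itself. -/
theorem isPureInjective_self (R : Type u) [CommRing R] [IsNoetherianRing R] [IsLocalRing R]
    [IsAdicComplete (maximalIdeal R) R] : IsPureInjective R R := by
  intro M N _ _ _ _ f hf g
  let π : (N →₀ R) →ₗ[R] N := Finsupp.linearCombination R id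
  have hπ : Function.Surjective π := fun n ↦ ⟨Finsupp.single n 1, by simp [π]⟩
  obtain ⟨φ, hφ⟩ := exists_linearMap_of_finitely_consistent
    {y : (N →₀ R) × R | ∃ m, π y.1 = f m ∧ y.2 = g m} fun F hF ↦ by
      choose m hm using fun y : F ↦ hF y.2
      obtain ⟨φ, hφ⟩ := hf.exists_linearMap π (fun y : F ↦ y.1.1) m fun y ↦ (hm y).1
      exact ⟨g ∘ₗ φ, fun y hy ↦ by
        rw [LinearMap.comp_apply, hφ ⟨y, hy⟩, (hm ⟨y, hy⟩).2]⟩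
  have hker : LinearMap.ker π ≤ LinearMap.ker φ := fun x hx ↦
    hφ (x, 0) ⟨0, by simpa using hx, by simp⟩
  refine ⟨(LinearMap.ker π).liftQ φ hker ∘ₗ (π.quotKerEquivOfSurjective hπ).symm, ?_⟩
  ext m
  obtain ⟨x, hx⟩ := hπ (f m)
  have hsymm : (π.quotKerEquivOfSurjective hπ).symm (f m) = (LinearMap.ker π).mkQ x := by
    rw [LinearEquiv.symm_apply_eq, ← hx]
    rfl
  rw [LinearMap.comp_apply, LinearMap.comp_apply, LinearEquiv.coe_coe, hsymm,
    Submodule.mkQ_apply, Submodule.liftQ_apply]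
  exact hφ (x, g m) ⟨m, hx, rfl⟩

/-- A local ring is indecomposable: it embeds into any nontrivial factor of a product
decomposition of itself. -/
lemma injective_proj_of_equiv_pi {R : Type*} [CommRing R] [IsLocalRing R] {ι : Type*}
    {A : ι → Type*} [∀ i, AddCommGroup (A i)] [∀ i, Module R (A i)] (e : R ≃ₗ[R] ∀ i, A i)
    (i : ι) [Nontrivial (A i)] : Function.Injective (LinearMap.proj i ∘ₗ e.toLinearMap) := by
  classical
  let c : R := e.symm (Pi.single i (e 1 i))
  have hc (r : R) : c * r = e.symm (Pi.single i (e r i)) := by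
    have : e r = r • e 1 := by rw [← map_smul, smul_eq_mul, mul_one]
    rw [this, Pi.smul_apply, Pi.single_smul, map_smul, smul_eq_mul, mul_comm]
  have hidem : c * (1 - c) = 0 := by
    rw [mul_sub, hc c]
    simp [c]
  have hcu : IsUnit c := by
    rcases isUnit_or_isUnit_one_sub_self c with h | h
    · exact h
    · obtain ⟨a, ha⟩ := exists_ne (0 : A i)
      have h0 := hc (e.symm (Pi.single i a))
      rw [(h.mul_left_eq_zero).1 hidem] at h0
      simp [ha, eq_comm (a := (0 : R))] at h0
  rw [injective_iff_map_eq_zero]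
  intro r hr
  have hr' : e r i = 0 := hr
  rw [← hcu.mul_right_eq_zero, hc, hr', Pi.single_zero, map_zero]

theorem complete_local_not_prod_artinian (R : Type u) [CommRing R] [IsNoetherianRing R]
    [IsLocalRing R] [IsAdicComplete (IsLocalRing.maximalIdeal R) R]
    (hR : ¬ IsArtinianRing R) :
    IsPureInjective R R ∧
      ¬ ∃ (ι : Type u) (A : ι → ModuleCat.{u} R), (∀ i, IsArtinian R (A i)) ∧
          Nonempty (R ≃ₗ[R] ∀ i, A i) := by
  refine ⟨isPureInjective_self R, ?_⟩
  rintro ⟨ι, A, hA, ⟨e⟩⟩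
  have : ∃ i, Nontrivial (A i) := by
    by_contra! h
    exact one_ne_zero (e.injective (Subsingleton.elim (e (1 : R)) (e 0)))
  obtain ⟨i, hi⟩ := this
  have := hA i
  exact hR (isArtinian_of_injective _ (injective_proj_of_equiv_pi e i))
end

section
/- An R-module D is pure injective if and only if D is isomorphic to a direct summand of a module of the form Hom_R(L, E), where E is an injective R-module and L is a direct sum of a family of finitely presented R-modules. -/
universe u

section PureInjective

open scoped TensorProduct

variable {R : Type u} [CommRing R]

/-- The character module of `R` is an injective `R`-module. -/
theorem injective_characterModule_self : Module.Injective R (CharacterModule R) :=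
  Module.Flat.iff_characterModule_injective.mp inferInstance

/-- The character module of `R` is a cogenerator. -/
theorem eq_zero_of_forall_linearMap_characterModule {M : Type*} [AddCommGroup M] [Module R M]
    {m : M} (h : ∀ ψ : M →ₗ[R] CharacterModule R, ψ m = 0) : m = 0 := by
  refine CharacterModule.eq_zero_of_character_apply fun c ↦ ?_
  have hc : c (TensorProduct.rid R M (m ⊗ₜ[R] 1)) = 0 := DFunLike.congr_fun
    (h (CharacterModule.curry (CharacterModule.dual (TensorProduct.rid R M).toLinearMap c))) 1
  rwa [TensorProduct.rid_tmul, one_smul] at hc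

theorem lTensor_rTensor_comm_apply {A B M N : Type*} [AddCommGroup A] [Module R A]
    [AddCommGroup B] [Module R B] [AddCommGroup M] [Module R M] [AddCommGroup N] [Module R N]
    (f : M →ₗ[R] N) (g : A →ₗ[R] B) (t : A ⊗[R] M) :
    f.lTensor B (g.rTensor M t) = g.rTensor N (f.lTensor A t) := by
  simp only [← LinearMap.comp_apply, LinearMap.lTensor_comp_rTensor,
    LinearMap.rTensor_comp_lTensor]

open LinearMap Submodule in
/-- Injectivity of `X ⊗ f` for all `X` can be tested on finitely presented modules `X`. -/
theorem lTensor_injective_of_finitePresentation {M N : Type*} [AddCommGroup M] [Module R M]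
    [AddCommGroup N] [Module R N] (f : M →ₗ[R] N)
    (hf : ∀ (n : ℕ) (K : Submodule R (Fin n → R)), K.FG →
      Function.Injective (f.lTensor ((Fin n → R) ⧸ K)))
    (X : Type*) [AddCommGroup X] [Module R X] : Function.Injective (f.lTensor X) := by
  rw [injective_iff_map_eq_zero]
  intro t ht
  obtain ⟨P, hP, t, rfl⟩ := TensorProduct.exists_of_fg t
  rw [lTensor_rTensor_comm_apply] at ht
  obtain ⟨Q, hPQ, hQ, ht⟩ := TensorProduct.eq_zero_of_fg_of_subtype_eq_zero hP ht
  rw [← lTensor_rTensor_comm_apply] at ht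
  rw [← subtype_comp_inclusion _ _ hPQ, rTensor_comp, comp_apply]
  generalize rTensor M (inclusion hPQ) t = t at ht ⊢
  have : Module.Finite R Q := Module.Finite.iff_fg.mpr hQ
  obtain ⟨n, p, hp⟩ := Module.Finite.exists_fin' R Q
  obtain ⟨s, rfl⟩ := rTensor_surjective M hp t
  rw [lTensor_rTensor_comm_apply] at ht
  obtain ⟨w, hw⟩ := (rTensor_exact N (exact_subtype_ker_map p) hp _).mp ht
  obtain ⟨K, hK, w, rfl⟩ := TensorProduct.exists_of_fg w
  have hKp : K.map (ker p).subtype ≤ ker p := map_subtype_le _ _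
  have hs : rTensor M (K.map (ker p).subtype).mkQ s = 0 := by
    refine (injective_iff_map_eq_zero _).mp (hf n _ (hK.map _)) _ ?_
    rw [lTensor_rTensor_comm_apply, ← hw, ← comp_apply, ← comp_apply, ← rTensor_comp, ← rTensor_comp]
    convert LinearMap.zero_apply w
    convert rTensor_zero N
    ext x : 1
    exact (Quotient.mk_eq_zero _).mpr (mem_map_of_mem x.2)
  rw [← liftQ_mkQ _ p hKp, rTensor_comp, comp_apply, hs, map_zero, map_zero]

/-- Pure injectivity passes to direct summands. -/
theorem IsPureInjective.of_retract {D D' : Type u} [AddCommGroup D] [Module R D]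
    [AddCommGroup D'] [Module R D'] (hD' : IsPureInjective R D') (f : D →ₗ[R] D')
    (g : D' →ₗ[R] D) (hgf : g ∘ₗ f = LinearMap.id) : IsPureInjective R D := by
  intro M N _ _ _ _ i hi k
  obtain ⟨h, hh⟩ := hD' M N i hi (f ∘ₗ k)
  exact ⟨g ∘ₗ h, by rw [LinearMap.comp_assoc, hh, ← LinearMap.comp_assoc, hgf, LinearMap.id_comp]⟩

/-- A module of homomorphisms into an injective module is pure injective. -/
theorem isPureInjective_linearMap (L E : Type u) [AddCommGroup L] [Module R L]
    [AddCommGroup E] [Module R E] [Module.Injective R E] : IsPureInjective R (L →ₗ[R] E) := by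
  intro M N _ _ _ _ i hi k
  obtain ⟨h, hh⟩ :=
    Module.Injective.extension_property R E _ _ (i.rTensor L) (hi.2 L) (TensorProduct.lift k)
  refine ⟨TensorProduct.curry h, ?_⟩
  ext m l
  simpa using DFunLike.congr_fun hh (m ⊗ₜ[R] l)

theorem isPureMono_of_lTensor_injective {M N : Type u} [AddCommGroup M] [Module R M]
    [AddCommGroup N] [Module R N] {f : M →ₗ[R] N}
    (hf : ∀ (X : Type u) [AddCommGroup X] [Module R X], Function.Injective (f.lTensor X)) :
    IsPureMono R f := by
  refine ⟨fun x y hxy ↦ ?_, fun X _ _ ↦ (f.lTensor_inj_iff_rTensor_inj X).mp (hf X)⟩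
  refine (TensorProduct.lid R M).symm.injective (hf R ?_)
  simp [hxy]

/-- If every map from a finitely presented module to `Hom(D, E)`, with `E` the character module
of `R`, factors through `π : L → Hom(D, E)`, then the evaluation map `D → Hom(L, E)` is pure. -/
theorem isPureMono_flip_of_factors {D L : Type u} [AddCommGroup D] [Module R D]
    [AddCommMonoid L] [Module R L] (π : L →ₗ[R] D →ₗ[R] CharacterModule R)
    (hπ : ∀ (n : ℕ) (K : Submodule R (Fin n → R)), K.FG →
      ∀ φ : ((Fin n → R) ⧸ K) →ₗ[R] D →ₗ[R] CharacterModule R,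
        ∃ j : ((Fin n → R) ⧸ K) →ₗ[R] L, π ∘ₗ j = φ) :
    IsPureMono R π.flip := by
  refine isPureMono_of_lTensor_injective (lTensor_injective_of_finitePresentation _ fun n K hK ↦ ?_)
  rw [injective_iff_map_eq_zero]
  refine fun t ht ↦ eq_zero_of_forall_linearMap_characterModule (R := R) fun ψ ↦ ?_
  obtain ⟨j, hj⟩ := hπ n K hK (TensorProduct.curry ψ)
  have hψ : TensorProduct.lift (LinearMap.id.flip ∘ₗ j) ∘ₗ π.flip.lTensor _ = ψ :=
    TensorProduct.ext' fun x d ↦ by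
      simpa using DFunLike.congr_fun (DFunLike.congr_fun hj x) d
  rw [← hψ, LinearMap.comp_apply, ht, map_zero]

/-- The evaluation map `D → Hom(⨁ i, L i, E)` attached to a family of maps `L i → Hom(D, E)`
through which every map from a finitely presented module factors is pure. -/
theorem isPureMono_flip_toModule {D : Type u} [AddCommGroup D] [Module R D] {ι : Type u}
    [DecidableEq ι] (L : ι → ModuleCat.{u} R)
    (ψ : ∀ i, L i →ₗ[R] D →ₗ[R] CharacterModule R)
    (hψ : ∀ (n : ℕ) (K : Submodule R (Fin n → R)), K.FG →
      ∀ φ : ((Fin n → R) ⧸ K) →ₗ[R] D →ₗ[R] CharacterModule R,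
        ∃ (i : ι) (j : ((Fin n → R) ⧸ K) →ₗ[R] L i), ψ i ∘ₗ j = φ) :
    IsPureMono R (DirectSum.toModule R ι _ ψ).flip := by
  refine isPureMono_flip_of_factors (DirectSum.toModule R ι _ ψ) fun n K hK φ ↦ ?_
  obtain ⟨i, j, hj⟩ := hψ n K hK φ
  refine ⟨DirectSum.lof R ι (fun i ↦ L i) i ∘ₗ j, ?_⟩
  rw [← hj]
  refine LinearMap.ext fun x ↦ ?_
  rw [LinearMap.comp_apply, LinearMap.comp_apply, LinearMap.comp_apply, DirectSum.toModule_lof]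

/-- Every module is a pure submodule of the module of homomorphisms from a direct sum of finitely
presented modules to the character module of `R`. -/
theorem exists_isPureMono_hom_directSum (D : Type u) [AddCommGroup D] [Module R D] :
    ∃ (ι : Type u) (L : ι → ModuleCat.{u} R), (∀ i, Module.FinitePresentation R (L i)) ∧
      ∃ f : D →ₗ[R] (DirectSum ι (fun i ↦ L i) →ₗ[R] CharacterModule R), IsPureMono R f := by
  classical
  let ι : Type u := Σ (n : ℕ) (K : {K : Submodule R (Fin n → R) // K.FG}),
    ((Fin n → R) ⧸ K.1) →ₗ[R] (D →ₗ[R] CharacterModule R)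
  refine ⟨ι, fun i ↦ ModuleCat.of R ((Fin i.1 → R) ⧸ i.2.1.1), fun i ↦ ?_, _,
    isPureMono_flip_toModule _ (fun i ↦ i.2.2) fun n K hK φ ↦ ⟨⟨n, ⟨K, hK⟩, φ⟩, LinearMap.id, rfl⟩⟩
  exact Module.finitePresentation_of_surjective i.2.1.1.mkQ (Submodule.mkQ_surjective _)
    (by rw [Submodule.ker_mkQ]; exact i.2.1.2)

end PureInjective

open DirectSum in
theorem pureInjective_iff_summand_hom_directSum (R : Type u) [CommRing R]
    (D : Type u) [AddCommGroup D] [Module R D] :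
    IsPureInjective R D ↔
      ∃ (E : ModuleCat.{u} R), Module.Injective R E ∧
        ∃ (ι : Type u) (L : ι → ModuleCat.{u} R),
          (∀ i, Module.FinitePresentation R (L i)) ∧
          ∃ (f : D →ₗ[R] (DirectSum ι (fun i => L i) →ₗ[R] E))
            (g : (DirectSum ι (fun i => L i) →ₗ[R] E) →ₗ[R] D), g ∘ₗ f = LinearMap.id := by
  constructor
  · intro hD
    obtain ⟨ι, L, hL, f, hf⟩ := exists_isPureMono_hom_directSum (R := R) D
    exact ⟨ModuleCat.of R (CharacterModule R), injective_characterModule_self, ι, L, hL, f,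
      hD _ _ f hf LinearMap.id⟩
  · rintro ⟨E, hE, ι, L, -, f, g, hgf⟩
    exact (isPureInjective_linearMap _ E).of_retract f g hgf
end

section
/- An R-module D is pure injective if and only if there is a family {T_λ}_{λ∈Λ} of R-algebras, each finitely presented as an R-module, such that D is isomorphic to a direct summand of a product Π_{λ∈Λ} E_λ, where each E_λ is an injective T_λ-module (viewed as an R-module via restriction of scalars). -/
universe u

/-- A bundled pair of an `R`-algebra together with a module over it. -/
structure AlgModPair (R : Type u) [CommRing R] where
  alg : Type u
  [algRing : CommRing alg]
  [algStr : Algebra R alg]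
  mod : Type u
  [modAcg : AddCommGroup mod]
  [modStr : Module alg mod]

attribute [instance] AlgModPair.algRing AlgModPair.algStr AlgModPair.modAcg AlgModPair.modStr

/-- The `R`-module structure on `p.mod` obtained by restriction of scalars along
`R → p.alg`. -/
instance (R : Type u) [CommRing R] (p : AlgModPair R) : Module R p.mod :=
  Module.compHom p.mod (algebraMap R p.alg)

open TensorProduct

theorem IsPureInjective.of_injective_over_algebra {R : Type u} [CommRing R] (T E : Type u)
    [CommRing T] [Algebra R T] [AddCommGroup E] [Module R E] [Module T E] [IsScalarTower R T E]
    [hE : Module.Injective T E] : IsPureInjective R E := by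
  intro M N _ _ _ _ f hf g
  have hinj : Function.Injective (f.baseChange T) :=
    (LinearMap.lTensor_inj_iff_rTensor_inj T f).mpr (hf.2 T)
  obtain ⟨h, hh⟩ := hE.out (f.baseChange T) hinj (g.liftBaseChange T)
  refine ⟨h.restrictScalars R ∘ₗ TensorProduct.mk R T N 1, LinearMap.ext fun x ↦ ?_⟩
  simpa using hh (1 ⊗ₜ x)

theorem IsPureInjective.pi {R : Type u} [CommRing R] {ι : Type u} {E : ι → Type u}
    [∀ i, AddCommGroup (E i)] [∀ i, Module R (E i)] (hE : ∀ i, IsPureInjective R (E i)) :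
    IsPureInjective R (∀ i, E i) := by
  intro M N _ _ _ _ f hf g
  choose h hh using fun i ↦ hE i M N f hf (LinearMap.proj i ∘ₗ g)
  exact ⟨LinearMap.pi h, LinearMap.ext fun x ↦ funext fun i ↦ LinearMap.congr_fun (hh i) x⟩

theorem IsPureInjective.of_retract_s19 {R : Type u} [CommRing R] {D E : Type u}
    [AddCommGroup D] [Module R D] [AddCommGroup E] [Module R E] (hE : IsPureInjective R E)
    (i : D →ₗ[R] E) (r : E →ₗ[R] D) (hri : r ∘ₗ i = LinearMap.id) : IsPureInjective R D := by
  intro M N _ _ _ _ f hf g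
  obtain ⟨h, hh⟩ := hE M N f hf (i ∘ₗ g)
  exact ⟨r ∘ₗ h, by rw [LinearMap.comp_assoc, hh, ← LinearMap.comp_assoc, hri, LinearMap.id_comp]⟩

section Purity

variable {R : Type*} [CommRing R] {M N L : Type*} [AddCommGroup M] [Module R M]
  [AddCommGroup N] [Module R N] [AddCommGroup L] [Module R L] {f : M →ₗ[R] N}

/-- Tensoring with a finite module is detected by tensoring with the finitely presented modules
mapping onto it. -/
theorem LinearMap.lTensor_injective_of_finite [Module.Finite R L]
    (h : ∀ (n : ℕ) (K : Submodule R (Fin n → R)), K.FG →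
      Function.Injective (f.lTensor ((Fin n → R) ⧸ K))) :
    Function.Injective (f.lTensor L) := by
  rw [injective_iff_map_eq_zero]
  intro z hz
  obtain ⟨n, p, hp⟩ := Module.Finite.exists_fin' R L
  obtain ⟨w, rfl⟩ := LinearMap.rTensor_surjective M hp z
  rw [← LinearMap.comp_apply, LinearMap.lTensor_comp_rTensor, ← LinearMap.rTensor_comp_lTensor,
    LinearMap.comp_apply] at hz
  obtain ⟨v, hv⟩ := (rTensor_exact N p.exact_subtype_ker_map hp _).mp hz
  obtain ⟨J, hJ, hle, y, rfl⟩ := Submodule.exists_fg_le_eq_rTensor_inclusion v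
  have hw : J.mkQ.rTensor M w = 0 := by
    refine (injective_iff_map_eq_zero _).mp (h n J hJ) _ ?_
    rw [← LinearMap.comp_apply, LinearMap.lTensor_comp_rTensor, ← LinearMap.rTensor_comp_lTensor,
      LinearMap.comp_apply, ← hv, ← LinearMap.comp_apply, ← LinearMap.comp_apply,
      ← LinearMap.rTensor_comp, ← LinearMap.rTensor_comp]
    have : J.mkQ ∘ₗ (LinearMap.ker p).subtype ∘ₗ Submodule.inclusion hle = 0 := by
      ext x
      simp
    rw [← LinearMap.comp_assoc] at this
    simp [this]
  rw [← Submodule.liftQ_mkQ J p hle, LinearMap.rTensor_comp, LinearMap.comp_apply, hw, map_zero]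

theorem LinearMap.lTensor_injective_of_finitelyPresented
    (h : ∀ (n : ℕ) (K : Submodule R (Fin n → R)), K.FG →
      Function.Injective (f.lTensor ((Fin n → R) ⧸ K))) :
    Function.Injective (f.lTensor L) := by
  rw [injective_iff_map_eq_zero]
  intro z hz
  obtain ⟨L', hL', hzL'⟩ :=
    TensorProduct.exists_finite_submodule_left_of_setFinite {z} (Set.finite_singleton z)
  obtain ⟨y, rfl⟩ := hzL' rfl
  rw [← LinearMap.comp_apply, LinearMap.lTensor_comp_rTensor, ← LinearMap.rTensor_comp_lTensor,
    LinearMap.comp_apply] at hz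
  obtain ⟨Q, hle, hQ, hy⟩ := TensorProduct.eq_zero_of_fg_of_subtype_eq_zero
    (Module.Finite.iff_fg.mp hL') hz
  have : Module.Finite R Q := Module.Finite.iff_fg.mpr hQ
  rw [← LinearMap.comp_apply, LinearMap.rTensor_comp_lTensor, ← LinearMap.lTensor_comp_rTensor,
    LinearMap.comp_apply] at hy
  have hy' := (injective_iff_map_eq_zero _).mp (LinearMap.lTensor_injective_of_finite h) _ hy
  rw [← Submodule.subtype_comp_inclusion L' Q hle, LinearMap.rTensor_comp, LinearMap.comp_apply,
    hy', map_zero]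

theorem LinearMap.lTensor_injective_of_retract {T : Type*} [AddCommGroup T] [Module R T]
    (s : L →ₗ[R] T) (r : T →ₗ[R] L) (hrs : r ∘ₗ s = LinearMap.id)
    (h : Function.Injective (f.lTensor T)) : Function.Injective (f.lTensor L) := by
  have hs : Function.Injective (s.rTensor M) :=
    Function.LeftInverse.injective (g := r.rTensor M) fun x ↦ by
      rw [← LinearMap.comp_apply, ← LinearMap.rTensor_comp, hrs, LinearMap.rTensor_id,
        LinearMap.id_apply]
  refine Function.Injective.of_comp (f := s.rTensor N) ?_
  rw [← LinearMap.coe_comp, LinearMap.rTensor_comp_lTensor, ← LinearMap.lTensor_comp_rTensor,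
    LinearMap.coe_comp]
  exact h.comp hs

theorem LinearMap.lTensor_injective_of_comp {P : Type*} [AddCommGroup P] [Module R P]
    (g : N →ₗ[R] P) (h : Function.Injective ((g ∘ₗ f).lTensor L)) :
    Function.Injective (f.lTensor L) := by
  rw [LinearMap.lTensor_comp, LinearMap.coe_comp] at h
  exact h.of_comp

theorem LinearMap.injective_of_lTensor_injective (h : Function.Injective (f.lTensor R)) :
    Function.Injective f := by
  intro x y hxy
  have := @h (1 ⊗ₜ x) (1 ⊗ₜ y) (by simp only [LinearMap.lTensor_tmul, hxy])
  simpa using congr(TensorProduct.lid R M $this)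

theorem LinearMap.lTensor_injective_of_baseChange {T E : Type*} [CommRing T] [Algebra R T]
    [AddCommGroup E] [Module R E] [Module T E] [IsScalarTower R T E]
    (j : T ⊗[R] M →ₗ[T] E) (hj : Function.Injective j) :
    Function.Injective ((j.restrictScalars R ∘ₗ TensorProduct.mk R T M 1).lTensor T) := by
  refine Function.Injective.of_comp
    (f := (LinearMap.id : E →ₗ[R] E).liftBaseChange T) ?_
  convert hj using 1
  funext x
  induction x with
  | zero => simp
  | tmul t m => simp [← map_smul, TensorProduct.smul_tmul']
  | add x y hx hy => simpa using congr($hx + $hy)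

end Purity

theorem IsPureMono.pi {R : Type u} [CommRing R] {D ι : Type u} [AddCommGroup D] [Module R D]
    {E : ι → Type u} [∀ i, AddCommGroup (E i)] [∀ i, Module R (E i)] (f : ∀ i, D →ₗ[R] E i)
    (h : ∀ (n : ℕ) (K : Submodule R (Fin n → R)), K.FG →
      ∃ i, Function.Injective ((f i).lTensor ((Fin n → R) ⧸ K))) :
    IsPureMono R (LinearMap.pi f) := by
  have hpure (L : Type u) [AddCommGroup L] [Module R L] :
      Function.Injective ((LinearMap.pi f).lTensor L) := by
    refine LinearMap.lTensor_injective_of_finitelyPresented fun n K hK ↦ ?_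
    obtain ⟨i, hi⟩ := h n K hK
    exact LinearMap.lTensor_injective_of_comp (LinearMap.proj i)
      (by rwa [LinearMap.proj_pi])
  exact ⟨LinearMap.injective_of_lTensor_injective (hpure R),
    fun L _ _ ↦ (LinearMap.lTensor_inj_iff_rTensor_inj L _).mp (hpure L)⟩

instance (R : Type u) [CommRing R] (p : AlgModPair R) : IsScalarTower R p.alg p.mod :=
  IsScalarTower.of_algebraMap_smul fun _ _ ↦ rfl

theorem Module.exists_injective_embedding_s19 (T : Type u) [CommRing T] (M : Type u)
    [AddCommGroup M] [Module T M] :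
    ∃ (E : Type u) (_ : AddCommGroup E) (_ : Module T E) (j : M →ₗ[T] E),
      Module.Injective T E ∧ Function.Injective j := by
  let X : ModuleCat.{u} T := ModuleCat.of T M
  let E : ModuleCat.{u} T := CategoryTheory.Injective.under X
  have : CategoryTheory.Injective (ModuleCat.of T E) :=
    inferInstanceAs (CategoryTheory.Injective (CategoryTheory.Injective.under X))
  exact ⟨E, inferInstance, inferInstance, (CategoryTheory.Injective.ι X).hom,
    Module.injective_module_of_injective_object T E,
    (ModuleCat.mono_iff_injective (CategoryTheory.Injective.ι X)).mp inferInstance⟩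

theorem AlgModPair.exists_lTensor_injective {R : Type u} [CommRing R] {D L : Type u}
    [AddCommGroup D] [Module R D] [AddCommGroup L] [Module R L] (P : AlgModPair R)
    (j : P.alg ⊗[R] D →ₗ[P.alg] P.mod) (hj : Function.Injective j)
    (s : L →ₗ[R] P.alg) (r : P.alg →ₗ[R] L) (hrs : r ∘ₗ s = LinearMap.id) :
    ∃ f : D →ₗ[R] P.mod, Function.Injective (f.lTensor L) :=
  ⟨j.restrictScalars R ∘ₗ TensorProduct.mk R P.alg D 1,
    LinearMap.lTensor_injective_of_retract s r hrs (LinearMap.lTensor_injective_of_baseChange j hj)⟩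

theorem exists_algModPair_lTensor_injective {R : Type u} [CommRing R] (D L : Type u)
    [AddCommGroup D] [Module R D] [AddCommGroup L] [Module R L] [Module.FinitePresentation R L] :
    ∃ P : AlgModPair R, Module.FinitePresentation R P.alg ∧ Module.Injective P.alg P.mod ∧
      ∃ f : D →ₗ[R] P.mod, Function.Injective (f.lTensor L) := by
  let : Module Rᵐᵒᵖ L := Module.compHom L ((RingHom.id R).fromOpposite mul_comm)
  have : IsCentralScalar R L := ⟨fun _ _ ↦ rfl⟩
  have : Module.FinitePresentation R (TrivSqZeroExt R L) :=
    inferInstanceAs (Module.FinitePresentation R (R × L))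
  obtain ⟨E, _, _, j, hE, hj⟩ :=
    Module.exists_injective_embedding_s19 (TrivSqZeroExt R L) (TrivSqZeroExt R L ⊗[R] D)
  exact ⟨{ alg := TrivSqZeroExt R L, mod := E }, this, hE,
    AlgModPair.exists_lTensor_injective _ j hj (TrivSqZeroExt.inrHom R L)
      (TrivSqZeroExt.sndHom R L) (LinearMap.ext fun _ ↦ rfl)⟩

theorem pureInjective_iff_summand_prod_injective_over_algebras (R : Type u) [CommRing R]
    (D : Type u) [AddCommGroup D] [Module R D] :
    IsPureInjective R D ↔
      ∃ (Λ : Type u) (P : Λ → AlgModPair R),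
        (∀ l, Module.FinitePresentation R (P l).alg) ∧
        (∀ l, Module.Injective (P l).alg (P l).mod) ∧
        ∃ (f : D →ₗ[R] ∀ l, (P l).mod) (g : (∀ l, (P l).mod) →ₗ[R] D),
          g ∘ₗ f = LinearMap.id := by
  constructor
  · intro hD
    have hfp (l : Σ n : ℕ, {K : Submodule R (Fin n → R) // K.FG}) :
        Module.FinitePresentation R ((Fin l.1 → R) ⧸ l.2.1) :=
      Module.finitePresentation_of_surjective l.2.1.mkQ l.2.1.mkQ_surjective
        (by simpa using l.2.2)
    choose P hP hE f hf using fun l : Σ n : ℕ, {K : Submodule R (Fin n → R) // K.FG} ↦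
      have := hfp l
      exists_algModPair_lTensor_injective (R := R) D ((Fin l.1 → R) ⧸ l.2.1)
    have hpure : IsPureMono R (LinearMap.pi f) := .pi f fun n K hK ↦ ⟨⟨n, K, hK⟩, hf ⟨n, K, hK⟩⟩
    obtain ⟨g, hg⟩ := hD D _ (LinearMap.pi f) hpure LinearMap.id
    exact ⟨_, P, hP, hE, LinearMap.pi f, g, hg⟩
  · rintro ⟨Λ, P, -, hE, f, g, hfg⟩
    exact IsPureInjective.of_retract_s19
      (.pi fun l ↦ .of_injective_over_algebra (P l).alg (P l).mod) f g hfg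
end
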